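/- Let F ∈ ℤ[x_1,x_2] be irreducible over ℚ of total degree d ≥ 1, let B_1, B_2 ≥ 1, and define N(F;B_1,B_2) = #{(x_1,x_2) ∈ ℤ² : F(x_1,x_2) = 0, |x_1| ≤ B_1, |x_2| ≤ B_2}. Let T = max{B_1^{e_1} B_2^{e_2}}, the maximum taken over all pairs (e_1,e_2) ∈ ℤ_{≥0}² such that the monomial x_1^{e_1} x_2^{e_2} occurs in F with nonzero coefficient. Then for every ε > 0 there is a constant c(d,ε) such that N(F;B_1,B_2) ≤ c(d,ε) · T^ε · exp( (log B_1 · log B_2) / log T ). -/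

import Mathlib

section Slices

open MvPolynomial

/-- First-order Taylor expansion of a multivariate polynomial in one of its variables. -/
theorem MvPolynomial.exists_eval_update_add {σ R : Type*} [CommRing R] [DecidableEq σ]
    (F : MvPolynomial σ R) (v : σ → R) (j : σ) (w : R) :
    ∃ r, eval (Function.update v j (v j + w)) F =
      eval v F + w * eval v (pderiv j F) + w ^ 2 * r := by
  induction F using MvPolynomial.induction_on with
  | C a => exact ⟨0, by simp⟩
  | add p q hp hq =>
    obtain ⟨r, hr⟩ := hp
    obtain ⟨s, hs⟩ := hq
    exact ⟨r + s, by simp only [map_add, hr, hs]; ring⟩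
  | mul_X p k hp =>
    obtain ⟨r, hr⟩ := hp
    by_cases hk : k = j
    · subst hk
      refine ⟨eval v (pderiv k p) + r * (v k + w), ?_⟩
      simp only [map_mul, eval_X, Function.update_self, hr, Derivation.leibniz, pderiv_X_self,
        map_add, smul_eq_mul, map_one]
      ring
    · refine ⟨r * v k, ?_⟩
      simp only [map_mul, eval_X, Function.update_of_ne hk, hr, Derivation.leibniz,
        pderiv_X_of_ne hk, map_add, smul_eq_mul, map_zero]
      ring

/-- The univariate polynomial obtained from a bivariate one by setting every variable other than
the `j`-th one to `a`. -/
noncomputable def MvPolynomial.slice {R : Type*} [CommRing R] (j : Fin 2) (a : R)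
    (F : MvPolynomial (Fin 2) R) : Polynomial R :=
  aeval (Function.update (fun _ => Polynomial.C a) j Polynomial.X) F

theorem MvPolynomial.eval_slice {R : Type*} [CommRing R] {i j : Fin 2} (hij : i ≠ j)
    (v : Fin 2 → R) (F : MvPolynomial (Fin 2) R) :
    (slice j (v i) F).eval (v j) = eval v F := by
  have key : ∀ k, k = i ∨ k = j := by lia
  induction F using MvPolynomial.induction_on with
  | C a => simp [slice]
  | add p q hp hq => simpa [slice] using congrArg₂ (· + ·) hp hq
  | mul_X p k hp =>
    have : (Function.update (fun _ => Polynomial.C (v i)) j Polynomial.X k).eval (v j) = v k := by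
      rcases key k with rfl | rfl
      · simp [Function.update_of_ne hij]
      · simp
    simp only [slice] at hp
    simp only [slice, map_mul, aeval_X, Polynomial.eval_mul, hp, this, eval_X]

theorem MvPolynomial.derivative_slice {R : Type*} [CommRing R] (j : Fin 2) (a : R)
    (F : MvPolynomial (Fin 2) R) :
    (slice j a F).derivative = slice j a (pderiv j F) := by
  induction F using MvPolynomial.induction_on with
  | C a => simp [slice, Polynomial.algebraMap_eq]
  | add p q hp hq => simpa [slice] using congrArg₂ (· + ·) hp hq
  | mul_X p k hp =>
    simp only [slice] at hp
    by_cases hk : k = j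
    · subst hk
      simp [slice, hp]; ring
    · simp [slice, hp, Function.update_of_ne hk, pderiv_X_of_ne hk]; ring

theorem MvPolynomial.natDegree_slice_le {R : Type*} [CommRing R] [Nontrivial R] (j : Fin 2) (a : R)
    (F : MvPolynomial (Fin 2) R) : (slice j a F).natDegree ≤ F.totalDegree := by
  have := MvPolynomial.aeval_natDegree_le F le_rfl
    (Function.update (fun _ => Polynomial.C a) j (Polynomial.X : Polynomial R)) (n := 1) ?_
  · simpa [slice] using this
  · intro k
    by_cases hk : k = j
    · subst hk; simp
    · simp [Function.update_of_ne hk]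

theorem MvPolynomial.card_le_totalDegree_of_slice_ne_zero {R : Type*} [CommRing R] [IsDomain R]
    {i j : Fin 2} (hij : i ≠ j) {F : MvPolynomial (Fin 2) R} {a : R} (hF : slice j a F ≠ 0)
    (S : Finset (Fin 2 → R)) (hi : ∀ v ∈ S, v i = a) (hS : ∀ v ∈ S, eval v F = 0) :
    S.card ≤ F.totalDegree := by
  classical
  have h1 : S.card = (S.image (fun v => v j)).card := by
    rw [Finset.card_image_of_injOn]
    intro v hv w hw h
    have key : ∀ k, k = i ∨ k = j := by lia
    funext k
    rcases key k with rfl | rfl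
    · rw [hi v hv, hi w hw]
    · exact h
  have h2 : S.image (fun v => v j) ⊆ (slice j a F).roots.toFinset := by
    intro y hy
    obtain ⟨v, hv, rfl⟩ := Finset.mem_image.1 hy
    simp only [Multiset.mem_toFinset, Polynomial.mem_roots hF, Polynomial.IsRoot.def]
    rw [← hi v hv, eval_slice hij, hS v hv]
  calc S.card ≤ (slice j a F).roots.toFinset.card := h1 ▸ Finset.card_le_card h2
    _ ≤ _ := Multiset.toFinset_card_le _
    _ ≤ _ := Polynomial.card_roots' _
    _ ≤ _ := natDegree_slice_le _ _ _

theorem MvPolynomial.card_le_totalDegree_of_pderiv_ne_zero {R : Type*} [CommRing R] [IsDomain R]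
    {i j : Fin 2} (hij : i ≠ j) {F : MvPolynomial (Fin 2) R} {a : R}
    (S : Finset (Fin 2 → R)) (hi : ∀ v ∈ S, v i = a) (hS : ∀ v ∈ S, eval v F = 0)
    (hS' : ∀ v ∈ S, eval v (pderiv j F) ≠ 0) :
    S.card ≤ F.totalDegree := by
  rcases S.eq_empty_or_nonempty with rfl | ⟨v, hv⟩
  · simp
  refine card_le_totalDegree_of_slice_ne_zero hij (a := a) ?_ S hi hS
  intro h
  apply hS' v hv
  rw [← eval_slice hij, hi v hv, ← derivative_slice, h]
  simp

theorem MvPolynomial.X_sub_C_dvd_of_slice_eq_zero {R : Type*} [CommRing R]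
    {i j : Fin 2} (hij : i ≠ j) {F : MvPolynomial (Fin 2) R} {a : R} (hF : slice j a F = 0) :
    X i - C a ∣ F := by
  have key : ∀ k, k = i ∨ k = j := by lia
  have h : ∀ F : MvPolynomial (Fin 2) R,
      X i - C a ∣ F - Polynomial.aeval (X j) (slice j a F) := by
    intro F
    induction F using MvPolynomial.induction_on with
    | C a => simp [slice]
    | add p q hp hq =>
      have := dvd_add hp hq
      simp only [slice, map_add] at this ⊢
      convert this using 1; ring
    | mul_X p k hp =>
      rcases key k with rfl | rfl
      · have := dvd_add (hp.mul_right (X k)) (Dvd.intro_left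
          (Polynomial.aeval (X j) (slice j a p)) (rfl : _ * (X k - C a) = _))
        convert this using 1
        simp [slice, Function.update_of_ne hij, MvPolynomial.algebraMap_eq]; ring
      · convert hp.mul_right (X k) using 1
        simp [slice]; ring
  simpa [hF] using h F

end Slices

section Bezout

open Polynomial in
theorem Polynomial.natDegree_resultant_le {R : Type*} [CommRing R] (f g : R[X][X]) (e : ℕ)
    (hf : ∀ k, (f.coeff k).natDegree ≤ e) (hg : ∀ k, (g.coeff k).natDegree ≤ e) :
    (resultant f g).natDegree ≤ (f.natDegree + g.natDegree) * e := by
  rw [resultant, Matrix.det_apply]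
  refine natDegree_sum_le_of_forall_le _ _ fun τ _ => (natDegree_smul_le _ _).trans
    ((natDegree_prod_le _ _).trans ((Finset.sum_le_card_nsmul _ _ e ?_).trans (by simp)))
  intro k _
  simp only [sylvester, Matrix.of_apply]
  refine Fin.addCases (fun l => ?_) (fun l => ?_) k
  · simp only [Fin.addCases_left]
    split_ifs
    · exact hg _
    · simp
  · simp only [Fin.addCases_right]
    split_ifs
    · exact hf _
    · simp

open Polynomial in
theorem Polynomial.resultant_ne_zero_of_irreducible {K : Type*} [Field K] {f g : K[X][X]}
    (hf : Irreducible f) (hdeg : f.natDegree ≠ 0) (hfg : ¬ f ∣ g) : resultant f g ≠ 0 := by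
  let L := FractionRing K[X]
  have hinj : Function.Injective (algebraMap K[X] L) := IsFractionRing.injective _ _
  have hprim : f.IsPrimitive := hf.isPrimitive hdeg
  have hirr : Irreducible (f.map (algebraMap K[X] L)) :=
    (hprim.irreducible_iff_irreducible_map_fraction_map).1 hf
  intro h
  have h1 : resultant (f.map (algebraMap K[X] L)) (g.map (algebraMap K[X] L)) = 0 := by
    rw [natDegree_map_eq_of_injective hinj, natDegree_map_eq_of_injective hinj,
      resultant_map_map, h, map_zero]
  rw [resultant_eq_zero_iff] at h1
  refine h1.2 ((hirr.coprime_iff_not_dvd).2 fun h2 => ?_)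
  exact hfg (hprim.dvd_of_fraction_map_dvd_fraction_map h2)

open MvPolynomial

/-- Bivariate polynomials as polynomials in the variable `X 0` over univariate polynomials in
`X 1`. -/
noncomputable def MvPolynomial.bivariateEquiv (K : Type*) [CommRing K] :
    MvPolynomial (Fin 2) K ≃ₐ[K] Polynomial (Polynomial K) :=
  (finSuccEquiv K 1).trans (Polynomial.mapAlgEquiv (uniqueAlgEquiv K (Fin 1)))

theorem MvPolynomial.eval_bivariateEquiv {K : Type*} [CommRing K] (F : MvPolynomial (Fin 2) K)
    (v : Fin 2 → K) :
    ((bivariateEquiv K F).eval (Polynomial.C (v 0))).eval (v 1) = eval v F := by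
  induction F using MvPolynomial.induction_on with
  | C a => simp [bivariateEquiv, finSuccEquiv_apply]
  | add p q hp hq => simpa using congrArg₂ (· + ·) hp hq
  | mul_X p k hp =>
    rw [map_mul, Polynomial.eval_mul, Polynomial.eval_mul, hp, map_mul]
    congr 1
    fin_cases k
    · simp [bivariateEquiv, finSuccEquiv_X_zero]
    · have : (X 1 : MvPolynomial (Fin 2) K) = X (Fin.succ 0) := rfl
      simp [bivariateEquiv, this, finSuccEquiv_X_succ]

theorem MvPolynomial.natDegree_bivariateEquiv {K : Type*} [CommRing K]
    (F : MvPolynomial (Fin 2) K) : (bivariateEquiv K F).natDegree = F.degreeOf 0 := by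
  rw [← natDegree_finSuccEquiv]
  exact Polynomial.natDegree_map_eq_of_injective
    (f := ((uniqueAlgEquiv K (Fin 1) : MvPolynomial (Fin 1) K →+* Polynomial K)))
    (uniqueAlgEquiv K (Fin 1)).injective _

theorem MvPolynomial.natDegree_coeff_bivariateEquiv_le {K : Type*} [CommRing K] [Nontrivial K]
    (F : MvPolynomial (Fin 2) K) (k : ℕ) :
    ((bivariateEquiv K F).coeff k).natDegree ≤ F.totalDegree := by
  have h : (bivariateEquiv K F).coeff k =
      aeval (fun _ => Polynomial.X) ((finSuccEquiv K 1 F).coeff k) := by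
    simp [bivariateEquiv, aeval_def, Polynomial.algebraMap_eq]
  rw [h]
  by_cases h0 : (finSuccEquiv K 1 F).coeff k = 0
  · simp [h0]
  · have h1 := totalDegree_coeff_finSuccEquiv_add_le F k h0
    have h2 := MvPolynomial.aeval_natDegree_le ((finSuccEquiv K 1 F).coeff k)
      (m := F.totalDegree) (by lia) (fun _ : Fin 1 => (Polynomial.X : Polynomial K)) (n := 1)
      (by simp)
    simpa using h2

theorem MvPolynomial.slice_ne_zero_of_irreducible {K : Type*} [Field K] {i j : Fin 2}
    (hij : i ≠ j) {F : MvPolynomial (Fin 2) K} (hF : Irreducible F) (hj : F.degreeOf j ≠ 0)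
    (a : K) : slice j a F ≠ 0 := by
  intro h
  obtain ⟨H, hH⟩ := X_sub_C_dvd_of_slice_eq_zero hij h
  have hunit : IsUnit H := by
    refine (hF.isUnit_or_isUnit hH).resolve_left fun h => ?_
    have := h.map (eval (fun _ : Fin 2 => a))
    simp at this
  have h1 : H.degreeOf j = 0 := by
    obtain ⟨c, -, rfl⟩ := MvPolynomial.isUnit_iff_eq_C_of_isReduced.1 hunit
    simp
  have h2 : (X i - C a : MvPolynomial (Fin 2) K).degreeOf j = 0 := by
    have := degreeOf_sub_le j (X i) (C a : MvPolynomial (Fin 2) K)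
    rw [degreeOf_X_of_ne hij.symm, degreeOf_C] at this
    lia
  have := degreeOf_mul_le j (X i - C a) H
  rw [← hH] at this
  lia

/-- A weak form of Bézout's theorem, with an irreducible first polynomial. -/
theorem MvPolynomial.card_common_zeros_le {K : Type*} [Field K] {F G : MvPolynomial (Fin 2) K}
    (hF : Irreducible F) (h0 : F.degreeOf 0 ≠ 0) (hFG : ¬ F ∣ G) (S : Finset (Fin 2 → K))
    (hSF : ∀ v ∈ S, eval v F = 0) (hSG : ∀ v ∈ S, eval v G = 0) :
    S.card ≤ F.totalDegree * (F.totalDegree + G.totalDegree) ^ 2 := by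
  classical
  set f := bivariateEquiv K F with hf
  set g := bivariateEquiv K G with hg
  have hfirr : Irreducible f := (MulEquiv.irreducible_iff (bivariateEquiv K)).2 hF
  have hdeg : f.natDegree ≠ 0 := by rwa [hf, natDegree_bivariateEquiv]
  have hfg : ¬ f ∣ g := fun h => hFG ((map_dvd_iff (bivariateEquiv K)).1 h)
  set R := Polynomial.resultant f g with hR
  have hR0 : R ≠ 0 := Polynomial.resultant_ne_zero_of_irreducible hfirr hdeg hfg
  have hRdeg : R.natDegree ≤ (F.totalDegree + G.totalDegree) ^ 2 := by
    refine (Polynomial.natDegree_resultant_le f g (F.totalDegree + G.totalDegree)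
      (fun k => (natDegree_coeff_bivariateEquiv_le F k).trans (by lia))
      (fun k => (natDegree_coeff_bivariateEquiv_le G k).trans (by lia))).trans ?_
    rw [sq]
    gcongr
    · rw [hf, natDegree_bivariateEquiv]; exact degreeOf_le_totalDegree _ _
    · rw [hg, natDegree_bivariateEquiv]; exact degreeOf_le_totalDegree _ _
  have himg : S.image (fun v => v 1) ⊆ R.roots.toFinset := by
    intro y hy
    obtain ⟨v, hv, rfl⟩ := Finset.mem_image.1 hy
    obtain ⟨p, q, -, -, hpq⟩ := Polynomial.exists_mul_add_mul_eq_C_resultant f g le_rfl le_rfl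
      (Or.inl hdeg)
    have := congrArg (fun P => (Polynomial.eval (Polynomial.C (v 0)) P).eval (v 1)) hpq
    simp only [Polynomial.eval_add, Polynomial.eval_mul, Polynomial.eval_C, hf, hg,
      eval_bivariateEquiv, hSF v hv, hSG v hv, zero_mul, add_zero] at this
    simp only [Multiset.mem_toFinset, Polynomial.mem_roots hR0, Polynomial.IsRoot.def]
    exact this.symm
  have hcard : (S.image (fun v => v 1)).card ≤ (F.totalDegree + G.totalDegree) ^ 2 :=
    (Finset.card_le_card himg).trans ((Multiset.toFinset_card_le _).trans
      ((Polynomial.card_roots' _).trans hRdeg))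
  refine (Finset.card_le_mul_card_image S F.totalDegree fun b _ => ?_).trans
    (Nat.mul_le_mul_left _ hcard)
  refine card_le_totalDegree_of_slice_ne_zero (i := 1) (j := 0) one_ne_zero (a := b)
    (slice_ne_zero_of_irreducible (i := 1) one_ne_zero hF h0 b) _ ?_ ?_
  · intro v hv
    exact (Finset.mem_filter.1 hv).2
  · intro v hv
    exact hSF v (Finset.mem_filter.1 hv).1

end Bezout

section AuxiliaryPolynomial

open MvPolynomial

theorem MvPolynomial.eval_monomial_fin_two {R : Type*} [CommRing R] (e : Fin 2 →₀ ℕ) (c : R)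
    (v : Fin 2 → R) : eval v (monomial e c) = c * (v 0 ^ e 0 * v 1 ^ e 1) := by
  rw [eval_monomial, Finsupp.prod_fintype _ _ (by simp), Fin.prod_univ_two]

theorem MvPolynomial.dvd_eval_sub_eval {σ : Type*} {n : ℤ} (F : MvPolynomial σ ℤ) {v w : σ → ℤ}
    (h : ∀ k, n ∣ v k - w k) : n ∣ eval v F - eval w F := by
  induction F using MvPolynomial.induction_on with
  | C a => simp
  | add p q hp hq =>
    simp only [map_add]
    rw [add_sub_add_comm]
    exact dvd_add hp hq
  | mul_X p k hp =>
    simp only [map_mul, eval_X]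
    have := dvd_add (hp.mul_right (v k)) ((h k).mul_left (eval w p))
    rwa [show (eval v p - eval w p) * v k + eval w p * (v k - w k) =
      eval v p * v k - eval w p * w k by ring] at this

/-- Hensel's lemma for a residue disc of a curve: the second coordinate is a polynomial function of
the first one modulo every power of `p`. -/
theorem exists_polynomial_dvd_sub_eval {p : ℕ} (hp : p.Prime) {F : MvPolynomial (Fin 2) ℤ}
    {S : Set (Fin 2 → ℤ)} (hS : ∀ v ∈ S, eval v F = 0) {v₀ : Fin 2 → ℤ}
    (hv₀ : ¬ (p : ℤ) ∣ eval v₀ (pderiv 1 F)) (hcong : ∀ v ∈ S, ∀ k, (p : ℤ) ∣ v k - v₀ k) (m : ℕ) :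
    ∃ g : Polynomial ℤ, ∀ v ∈ S, (p : ℤ) ^ (m + 1) ∣ v 1 - g.eval (v 0) := by
  induction m with
  | zero => exact ⟨Polynomial.C (v₀ 1), fun v hv => by simpa using hcong v hv 1⟩
  | succ m ih =>
    obtain ⟨g, hg⟩ := ih
    have hcop : IsCoprime (p : ℤ) (eval v₀ (pderiv 1 F)) :=
      ((Nat.prime_iff_prime_int.1 hp).coprime_iff_not_dvd).2 hv₀
    obtain ⟨a, b, hab⟩ := hcop
    refine ⟨g - Polynomial.C b * aeval ![Polynomial.X, g] F, fun v hv => ?_⟩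
    obtain ⟨w, hw⟩ := hg v hv
    obtain ⟨r, hr⟩ := exists_eval_update_add F v 1 (-((p : ℤ) ^ (m + 1) * w))
    obtain ⟨t, ht⟩ := dvd_eval_sub_eval (pderiv 1 F) (hcong v hv)
    have heval : (aeval ![Polynomial.X, g] F).eval (v 0) =
        eval (Function.update v 1 (v 1 + -((p : ℤ) ^ (m + 1) * w))) F := by
      have h1 : (aeval ![Polynomial.X, g] F).eval (v 0) =
          eval (fun k => (![Polynomial.X, g] k).eval (v 0)) F := by
        rw [← Polynomial.coe_evalRingHom, aeval_def, hom_eval₂]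
        exact congrArg (fun φ => eval₂ φ _ F) (RingHom.ext_int _ _)
      rw [h1]
      congr 2
      funext k
      fin_cases k
      · simp
      · simp; linarith
    rw [Polynomial.eval_sub, Polynomial.eval_mul, Polynomial.eval_C, heval, hr, hS v hv]
    refine ⟨w * (a - b * t) + b * (p ^ m * w ^ 2 * r), ?_⟩
    have h2 : eval v (pderiv 1 F) = eval v₀ (pderiv 1 F) + p * t := by linarith
    have h3 : v 1 = Polynomial.eval (v 0) g + p ^ (m + 1) * w := by linarith
    rw [h2, h3]
    have h4 : b * eval v₀ (pderiv 1 F) = 1 - a * p := by linarith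
    linear_combination (-(p : ℤ) ^ (m + 1) * w) * h4

/-- Pigeonhole principle for congruences of varying strength modulo powers of `p`: an integer
vector with entries of prescribed size. -/
theorem exists_ne_zero_forall_pow_dvd_sum {ι : Type*} [Fintype ι] {p : ℕ} (hp : p.Prime) (s : ℕ)
    (a : ι → ℕ → ℤ) (N : ι → ℕ) (hN : p ^ (∑ k : Fin s, (s - (k : ℕ))) < ∏ i, (N i + 1)) :
    ∃ c : ι → ℤ, c ≠ 0 ∧ (∀ i, |c i| ≤ N i) ∧
      ∀ k < s, (p : ℤ) ^ (s - k) ∣ ∑ i, c i * a i k := by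
  classical
  have : ∀ k, NeZero (p ^ k) := fun k => ⟨pow_ne_zero _ hp.ne_zero⟩
  let box : Finset (ι → ℕ) := Fintype.piFinset fun i => Finset.range (N i + 1)
  let f : (ι → ℕ) → (∀ k : Fin s, ZMod (p ^ (s - (k : ℕ)))) :=
    fun c k => ((∑ i, (c i : ℤ) * a i k : ℤ) : ZMod (p ^ (s - (k : ℕ))))
  have hcard : (Finset.univ : Finset (∀ k : Fin s, ZMod (p ^ (s - (k : ℕ))))).card < box.card := by
    rw [Finset.card_univ, Fintype.card_pi, Fintype.card_piFinset]
    simpa [ZMod.card, Finset.prod_pow_eq_pow_sum] using hN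
  obtain ⟨x, hx, y, hy, hxy, hf⟩ := Finset.exists_ne_map_eq_of_card_lt_of_maps_to hcard
    (f := f) (fun _ _ => Finset.mem_coe.2 (Finset.mem_univ _))
  have hx' : ∀ i, x i < N i + 1 := by simpa [box] using hx
  have hy' : ∀ i, y i < N i + 1 := by simpa [box] using hy
  refine ⟨fun i => (x i : ℤ) - y i, fun h => hxy ?_, fun i => ?_, fun k hk => ?_⟩
  · funext i
    have := congrFun h i
    simp only [Pi.zero_apply] at this
    lia
  · have := hx' i
    have := hy' i
    rw [abs_le]
    constructor <;> lia
  · have := congrFun hf ⟨k, hk⟩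
    simp only [f] at this
    rw [eq_comm, ZMod.intCast_eq_intCast_iff_dvd_sub] at this
    convert this using 1
    · push_cast; rfl
    · rw [← Finset.sum_sub_distrib]
      exact Finset.sum_congr rfl fun i _ => by ring

/-- The points of a curve in a residue disc around a point where it is smooth modulo `p` lie on an
auxiliary curve supported on a prescribed set `E` of monomials, as soon as `p` is large in terms of
the sizes `W e` of those monomials. -/
theorem exists_auxiliary_polynomial {p : ℕ} (hp : p.Prime) {F : MvPolynomial (Fin 2) ℤ}
    {S : Set (Fin 2 → ℤ)} (hS : ∀ v ∈ S, eval v F = 0) {v₀ : Fin 2 → ℤ}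
    (hv₀ : ¬ (p : ℤ) ∣ eval v₀ (pderiv 1 F)) (hcong : ∀ v ∈ S, ∀ k, (p : ℤ) ∣ v k - v₀ k)
    (E : Finset (Fin 2 →₀ ℕ)) (hE : E.Nonempty) (W : (Fin 2 →₀ ℕ) → ℝ) (hW : ∀ e ∈ E, 0 < W e)
    (hSW : ∀ v ∈ S, ∀ e ∈ E, |((v 0 : ℝ) ^ e 0 * (v 1 : ℝ) ^ e 1)| ≤ W e)
    (hsize : (p : ℝ) ^ (∑ k : Fin E.card, (E.card - (k : ℕ))) * ((2 * E.card) ^ E.card * ∏ e ∈ E, W e)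
      ≤ (p : ℝ) ^ (E.card * E.card)) :
    ∃ G : MvPolynomial (Fin 2) ℤ, G ≠ 0 ∧ G.support ⊆ E ∧ ∀ v ∈ S, eval v G = 0 := by
  classical
  set s := E.card with hs
  have hs0 : 0 < s := hE.card_pos
  obtain ⟨m, hm⟩ : ∃ m, s = m + 1 := ⟨s - 1, by lia⟩
  obtain ⟨g, hg⟩ := exists_polynomial_dvd_sub_eval hp hS hv₀ hcong m
  rw [← hm] at hg
  have hp0 : (0 : ℝ) < p := by exact_mod_cast hp.pos
  let Q : E → Polynomial ℤ := fun e =>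
    (Polynomial.X ^ (e.1 0) * g ^ (e.1 1)).comp (Polynomial.X + Polynomial.C (v₀ 0))
  let Y : E → ℝ := fun e => (p : ℝ) ^ s / (2 * s * W e.1)
  have hY : ∀ e, 0 < Y e := fun e => by
    have := hW e.1 e.2
    positivity
  have hN : p ^ (∑ k : Fin s, (s - (k : ℕ))) < ∏ e : E, (⌊Y e⌋₊ + 1) := by
    have h1 : ∏ e : E, Y e < ∏ e : E, ((⌊Y e⌋₊ : ℝ) + 1) :=
      Finset.prod_lt_prod_of_nonempty (fun e _ => hY e) (fun e _ => Nat.lt_floor_add_one _)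
        (Finset.univ_nonempty_iff.2 hE.to_subtype)
    have hWpos : 0 < ∏ e ∈ E, W e := Finset.prod_pos hW
    have h2 : ∏ e : E, Y e = (p : ℝ) ^ (s * s) / ((2 * s) ^ s * ∏ e ∈ E, W e) := by
      rw [Finset.prod_coe_sort E (fun e => (p : ℝ) ^ s / (2 * s * W e)), Finset.prod_div_distrib,
        Finset.prod_const, Finset.prod_mul_distrib, Finset.prod_const, ← pow_mul]
    have h3 : (p : ℝ) ^ (∑ k : Fin s, (s - (k : ℕ))) ≤ ∏ e : E, Y e := by
      rw [h2, le_div_iff₀ (by positivity)]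
      exact hsize
    exact_mod_cast h3.trans_lt h1
  obtain ⟨c, hc0, hcN, hc⟩ := exists_ne_zero_forall_pow_dvd_sum hp s
    (fun e k => (Q e).coeff k) (fun e => ⌊Y e⌋₊) hN
  let G : MvPolynomial (Fin 2) ℤ := ∑ e : E, monomial e.1 (c e)
  have hcoeff : ∀ e : E, coeff e.1 G = c e := fun e => by
    simp [G, coeff_sum, coeff_monomial]
  refine ⟨G, fun h => hc0 ?_, ?_, fun v hv => ?_⟩
  · funext e
    simp [← hcoeff, h]
  · intro e he
    by_contra hne
    rw [mem_support_iff] at he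
    apply he
    simp only [G, coeff_sum, coeff_monomial]
    exact Finset.sum_eq_zero fun e' _ => if_neg fun (h : e'.1 = e) => hne (h ▸ e'.2)
  · have heval : eval v G = ∑ e : E, c e * (v 0 ^ e.1 0 * v 1 ^ e.1 1) := by
      simp only [G, map_sum, eval_monomial_fin_two]
    have hdvd : (p : ℤ) ^ s ∣ eval v G := by
      let P : Polynomial ℤ := ∑ e : E, Polynomial.C (c e) * Q e
      have h1 : (p : ℤ) ^ s ∣ P.eval (v 0 - v₀ 0) := by
        rw [Polynomial.eval_eq_sum_range]
        refine Finset.dvd_sum fun k _ => ?_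
        have h2 : (p : ℤ) ^ k ∣ (v 0 - v₀ 0) ^ k := pow_dvd_pow_of_dvd (hcong v hv 0) k
        by_cases hk : k < s
        · have h3 := hc k hk
          have h4 : P.coeff k = ∑ e : E, c e * (Q e).coeff k := by
            simp [P, Polynomial.finsetSum_coeff]
          rw [h4]
          have := mul_dvd_mul h3 h2
          rwa [← pow_add, Nat.sub_add_cancel hk.le] at this
        · exact ((pow_dvd_pow _ (not_lt.1 hk)).trans h2).mul_left _
      have h2 : P.eval (v 0 - v₀ 0) = ∑ e : E, c e * (v 0 ^ e.1 0 * (g.eval (v 0)) ^ e.1 1) := by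
        simp [P, Q, Polynomial.eval_finsetSum]
      rw [h2] at h1
      rw [heval]
      refine (dvd_iff_dvd_of_dvd_sub ?_).2 h1
      · rw [← Finset.sum_sub_distrib]
        refine Finset.dvd_sum fun e _ => ?_
        rw [← mul_sub, ← mul_sub]
        refine Dvd.dvd.mul_left (Dvd.dvd.mul_left ?_ _) _
        exact (hg v hv).trans (sub_dvd_pow_sub_pow _ _ _)
    refine Int.eq_zero_of_abs_lt_dvd hdvd ?_
    have hbound : |((eval v G : ℤ) : ℝ)| ≤ (p : ℝ) ^ s / 2 := by
      rw [heval]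
      push_cast
      refine (Finset.abs_sum_le_sum_abs _ _).trans ?_
      have : ∀ e : E, |(c e : ℝ) * ((v 0 : ℝ) ^ e.1 0 * (v 1 : ℝ) ^ e.1 1)| ≤
          (p : ℝ) ^ s / (2 * s) := by
        intro e
        have hWe := hW e.1 e.2
        rw [abs_mul]
        have h1 : |(c e : ℝ)| ≤ Y e := by
          have h2 : |(c e : ℝ)| ≤ (⌊Y e⌋₊ : ℝ) := by exact_mod_cast hcN e
          exact h2.trans (Nat.floor_le (hY e).le)
        refine (mul_le_mul h1 (hSW v hv e.1 e.2) (abs_nonneg _) (hY e).le).trans_eq ?_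
        simp only [Y]
        field_simp
      refine (Finset.sum_le_sum fun e _ => this e).trans_eq ?_
      have hs0' : (s : ℝ) ≠ 0 := by positivity
      simp only [Finset.sum_const, Finset.card_univ, Fintype.card_coe, ← hs, nsmul_eq_mul]
      field_simp
    have hlt : |((eval v G : ℤ) : ℝ)| < (p : ℝ) ^ s :=
      hbound.trans_lt (half_lt_self (by positivity))
    exact_mod_cast hlt

end AuxiliaryPolynomial

section LeadingMonomial

open MvPolynomial

/-- For any pair of nonnegative weights, a nonzero bivariate polynomial has a monomial of maximal
weight dividing some monomial of each of its nonzero multiples. -/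
theorem MvPolynomial.exists_max_weight_le_support_mul {K : Type*} [CommRing K] [IsDomain K]
    {F : MvPolynomial (Fin 2) K} (hF : F ≠ 0) (b₁ b₂ : ℝ) :
    ∃ m ∈ F.support, (∀ e ∈ F.support, e 0 * b₁ + e 1 * b₂ ≤ m 0 * b₁ + m 1 * b₂) ∧
      ∀ G, G ≠ 0 → F ∣ G → ∃ e ∈ G.support, m ≤ e := by
  let key : (Fin 2 →₀ ℕ) → ℝ ×ₗ ℕ ×ₗ ℕ :=
    fun e => toLex (e 0 * b₁ + e 1 * b₂, toLex (e 0, e 1))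
  have hadd : ∀ a b, key (a + b) = key a + key b := fun a b => by
    simp only [key, Finsupp.add_apply, ← toLex_add, Prod.mk_add_mk]
    push_cast
    congr 2
    ring
  have hinj : ∀ a b, key a = key b → a = b := fun a b h => by
    simp only [key, EmbeddingLike.apply_eq_iff_eq, Prod.mk.injEq] at h
    ext k
    fin_cases k
    · exact h.2.1
    · exact h.2.2
  have hne : ∀ {P : MvPolynomial (Fin 2) K}, P ≠ 0 → P.support.Nonempty := fun h =>
    Finset.nonempty_iff_ne_empty.2 (by simpa using h)
  obtain ⟨m, hm, hmax⟩ := Finset.exists_max_image F.support key (hne hF)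
  refine ⟨m, hm, fun e he => ?_, ?_⟩
  · have := hmax e he
    simp only [key, Prod.Lex.toLex_le_toLex] at this
    rcases this with h | h
    · exact h.le
    · exact h.1.le
  · rintro _ hG ⟨H, rfl⟩
    have hH : H ≠ 0 := right_ne_zero_of_mul hG
    obtain ⟨h, hh, hhmax⟩ := Finset.exists_max_image H.support key (hne hH)
    refine ⟨m + h, ?_, le_self_add⟩
    rw [mem_support_iff] at hm hh ⊢
    rw [coeff_mul, Finset.sum_eq_single (m, h)]
    · exact mul_ne_zero hm hh
    · rintro ⟨a, b⟩ hab hne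
      rw [Finset.HasAntidiagonal.mem_antidiagonal] at hab
      by_contra h0
      have ha := hmax a (mem_support_iff.2 (left_ne_zero_of_mul h0))
      have hb := hhmax b (mem_support_iff.2 (right_ne_zero_of_mul h0))
      have hk : key a + key b = key m + key h := by rw [← hadd, ← hadd, hab]
      obtain ⟨h1, h2⟩ := (add_eq_add_iff_eq_and_eq ha hb).1 hk
      exact hne (by rw [hinj _ _ h1, hinj _ _ h2])
    · intro h
      simp at h

end LeadingMonomial

section Siegel

open MvPolynomial

/-- A polynomial of small height, supported on the monomials of `F`, through the zeros of `F` in a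
finite set. -/
theorem MvPolynomial.exists_small_height {F : MvPolynomial (Fin 2) ℤ} (hF : F ≠ 0)
    (S : Finset (Fin 2 → ℤ)) (hS : ∀ v ∈ S, eval v F = 0) {T : ℝ} (hT : 1 ≤ T)
    (hST : ∀ v ∈ S, ∀ e ∈ F.support, |((v 0 : ℝ) ^ e 0 * (v 1 : ℝ) ^ e 1)| ≤ T) :
    ∃ G : MvPolynomial (Fin 2) ℤ, G ≠ 0 ∧ G.support ⊆ F.support ∧ (∀ v ∈ S, eval v G = 0) ∧
      ∀ e, |((coeff e G : ℤ) : ℝ)| ≤ (F.support.card * T) ^ F.support.card := by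
  classical
  set n := F.support.card with hn
  have hFs : F.support.Nonempty := Finset.nonempty_iff_ne_empty.2 (by simpa using hF)
  have hn0 : 0 < n := hFs.card_pos
  have hn1 : (1 : ℝ) ≤ n := by exact_mod_cast hn0
  have hnT : 1 ≤ n * T := by nlinarith
  let u : S → F.support → ℚ := fun v e => (v.1 0 : ℚ) ^ e.1 0 * (v.1 1 : ℚ) ^ e.1 1
  let pair : (F.support → ℤ) → (F.support → ℚ) →ₗ[ℚ] ℚ :=
    fun c => ∑ e, (c e : ℚ) • LinearMap.proj e
  have hpair : ∀ c x, pair c x = ∑ e, (c e : ℚ) * x e := fun c x => by simp [pair]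
  obtain ⟨κ, a, ha, hspan, hli⟩ := exists_linearIndependent' ℚ u
  have : Finite κ := Finite.of_injective a ha
  have := Fintype.ofFinite κ
  have hlt : Fintype.card κ < Fintype.card F.support := by
    have h1 : Module.finrank ℚ (Submodule.span ℚ (Set.range (u ∘ a))) = Fintype.card κ :=
      finrank_span_eq_card hli
    have h2 : Submodule.span ℚ (Set.range (u ∘ a)) ≠ ⊤ := by
      intro htop
      have h3 : pair (fun e => coeff e.1 F) = 0 := by
        apply LinearMap.ker_eq_top.1
        rw [eq_top_iff, ← htop, hspan, Submodule.span_le]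
        rintro _ ⟨v, rfl⟩
        rw [SetLike.mem_coe, LinearMap.mem_ker, hpair]
        have h4 := hS v.1 v.2
        rw [F.as_sum, map_sum] at h4
        simp only [eval_monomial_fin_two] at h4
        rw [← Finset.sum_coe_sort] at h4
        simp only [u]
        exact_mod_cast h4
      obtain ⟨e, he⟩ := hFs
      have h5 := congrArg (fun φ => φ (Pi.single ⟨e, he⟩ 1)) h3
      simp only [hpair, Pi.single_apply, mul_ite, mul_one, mul_zero, Finset.sum_ite_eq',
        Finset.mem_univ, if_true, LinearMap.zero_apply, Int.cast_eq_zero] at h5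
      exact mem_support_iff.1 he h5
    have h3 := Submodule.finrank_lt h2
    rwa [h1, Module.finrank_fintype_fun_eq_card] at h3
  obtain ⟨t, ht0, htu, htn⟩ : ∃ t : F.support → ℤ, t ≠ 0 ∧ (∀ k, pair t (u (a k)) = 0) ∧
      ∀ e, |(t e : ℝ)| ≤ (n * T) ^ n := by
    rcases Nat.eq_zero_or_pos (Fintype.card κ) with h0 | hpos
    · have : IsEmpty κ := Fintype.card_eq_zero_iff.1 h0
      have : Nonempty F.support := hFs.to_subtype
      exact ⟨1, one_ne_zero, fun k => isEmptyElim k, fun e => by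
        simpa using one_le_pow₀ hnT⟩
    · let A : Matrix κ F.support ℤ :=
        Matrix.of fun k e => (a k).1 0 ^ e.1 0 * (a k).1 1 ^ e.1 1
      obtain ⟨t, ht0, htA, htn⟩ := Int.Matrix.exists_ne_zero_int_vec_norm_le A hlt hpos
      refine ⟨t, ht0, fun k => ?_, fun e => ?_⟩
      · have := congrFun htA k
        simp only [Matrix.mulVec, dotProduct, A, Matrix.of_apply, Pi.zero_apply] at this
        rw [hpair]
        simp only [u]
        rw [← Int.cast_zero, ← this]
        push_cast
        exact Finset.sum_congr rfl fun e _ => mul_comm _ _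
      · have h1 : |(t e : ℝ)| ≤ ‖t‖ := by
          have := norm_le_pi_norm t e
          rwa [Int.norm_eq_abs] at this
        refine h1.trans (htn.trans ?_)
        have hA : ∀ k e, ‖A k e‖ ≤ T := fun k e => by
          rw [Int.norm_eq_abs]
          simpa [A] using hST (a k).1 (a k).2 e.1 e.2
        have hAT : (letI := @Matrix.seminormedAddCommGroup κ F.support ℤ _ _ _; ‖A‖) ≤ T :=
          (Matrix.norm_le_iff (by linarith)).2 hA
        have hcast : (Fintype.card F.support : ℝ) = n := by simp [hn]
        rw [hcast]
        have hbase := mul_le_mul_of_nonneg_left (max_le hT hAT) (Nat.cast_nonneg (α := ℝ) n)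
        have hbase1 := mul_le_mul_of_nonneg_left (le_max_left 1
          (letI := @Matrix.seminormedAddCommGroup κ F.support ℤ _ _ _; ‖A‖))
          (Nat.cast_nonneg (α := ℝ) n)
        have hcard : (Fintype.card κ : ℝ) + 1 ≤ n := by
          rw [← hcast]; exact_mod_cast hlt
        have hexp : (Fintype.card κ : ℝ) / (n - Fintype.card κ) ≤ n := by
          rw [div_le_iff₀ (by linarith)]
          nlinarith
        refine (Real.rpow_le_rpow_of_exponent_le (by linarith) hexp).trans ?_
        rw [Real.rpow_natCast]
        exact pow_le_pow_left₀ (by linarith) hbase _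
  have hcoeff : ∀ e : F.support, coeff e.1 (∑ e : F.support, monomial e.1 (t e)) = t e :=
    fun e => by simp [coeff_sum, coeff_monomial]
  have hcoeff' : ∀ e ∉ F.support, coeff e (∑ e : F.support, monomial e.1 (t e)) = 0 := by
    intro e he
    simp only [coeff_sum, coeff_monomial]
    exact Finset.sum_eq_zero fun e' _ => if_neg fun (h : e'.1 = e) => he (h ▸ e'.2)
  refine ⟨∑ e : F.support, monomial e.1 (t e), fun h => ht0 ?_, fun e he => ?_, fun v hv => ?_,
    fun e => ?_⟩
  · funext e
    rw [← hcoeff, h]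
    simp
  · by_contra hne
    exact mem_support_iff.1 he (hcoeff' e hne)
  · have h1 : Submodule.span ℚ (Set.range u) ≤ LinearMap.ker (pair t) := by
      rw [← hspan, Submodule.span_le]
      rintro _ ⟨k, rfl⟩
      exact htu k
    have h2 : pair t (u ⟨v, hv⟩) = 0 := h1 (Submodule.subset_span ⟨_, rfl⟩)
    rw [hpair] at h2
    simp only [u] at h2
    simp only [map_sum, eval_monomial_fin_two]
    exact_mod_cast h2
  · by_cases he : e ∈ F.support
    · rw [hcoeff ⟨e, he⟩]
      exact htn _
    · rw [hcoeff' e he, Int.cast_zero, abs_zero]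
      positivity

end Siegel

section MonomialSet

/-- The cumulative weight of a rectangle of exponents is controlled by its area. -/
theorem sum_rectangle_weight_le (a b : ℕ) {x y : ℝ} (hx : 0 ≤ x) (hy : 0 ≤ y) :
    ∑ e ∈ Finset.range a ×ˢ Finset.range b, ((e.1 : ℝ) * x + e.2 * y) ≤
      a * b * (a * x + b * y / 2) := by
  rw [Finset.sum_product]
  have h1 : ∀ n : ℕ, ∑ j ∈ Finset.range n, (j : ℝ) ≤ (n : ℝ) ^ 2 / 2 := by
    intro n
    induction n with
    | zero => simp
    | succ n ih =>
      rw [Finset.sum_range_succ]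
      push_cast
      nlinarith
  have h2 : ∀ i ∈ Finset.range a, ∑ j ∈ Finset.range b, ((i : ℝ) * x + j * y) ≤
      b * (a * x + b * y / 2) := by
    intro i hi
    have hi' : (i : ℝ) ≤ a := by exact_mod_cast (Finset.mem_range.1 hi).le
    rw [Finset.sum_add_distrib, Finset.sum_const, Finset.card_range, nsmul_eq_mul, ← Finset.sum_mul]
    have h3 := mul_le_mul_of_nonneg_right (h1 b) hy
    have h4 := mul_le_mul_of_nonneg_left (mul_le_mul_of_nonneg_right hi' hx)
      (Nat.cast_nonneg (α := ℝ) b)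
    nlinarith
  refine (Finset.sum_le_sum h2).trans_eq ?_
  simp
  ring

set_option maxHeartbeats 1000000 in
/-- An `L`-shaped set of exponents, none of which dominates `(m₁, m₂)`, with small total weight
compared to the square of its cardinality. -/
theorem exists_exponent_pairs {d : ℕ} {ε : ℝ} (hε : 0 < ε) :
    ∃ D : ℕ, ∀ m₁ m₂ : ℕ, m₁ ≤ d → m₂ ≤ d → ∀ b₁ b₂ τ : ℝ, 0 < b₁ → 0 < b₂ →
      τ = m₁ * b₁ + m₂ * b₂ → b₁ ≤ τ → b₂ ≤ τ → ε * τ ≤ b₁ → ε * τ ≤ b₂ →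
      ∃ E : Finset (ℕ × ℕ), 3 ≤ E.card ∧ (∀ e ∈ E, e.1 < m₁ ∨ e.2 < m₂) ∧
        (∀ e ∈ E, e.1 + e.2 ≤ D) ∧
        ∑ e ∈ E, ((e.1 : ℝ) * b₁ + e.2 * b₂) ≤
          (ε * τ + b₁ * b₂ / τ) * (E.card * (E.card - 1) / 2) := by
  classical
  set c : ℝ := (d : ℝ) ^ 2 + 2 with hc
  set K : ℝ := 1 + 2 * c + (3 + 2 * c) / ε with hK
  have hc1 : 1 ≤ c := by rw [hc]; linarith [sq_nonneg (d : ℝ)]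
  have hKε : ε * (K - 1 - 2 * c) = 3 + 2 * c := by rw [hK]; field_simp; ring
  have hK1 : 2 * c ≤ K - 1 := by
    have : 0 ≤ (3 + 2 * c) / ε := by positivity
    linarith
  refine ⟨⌈d + K / ε⌉₊, fun m₁ m₂ hm₁ hm₂ b₁ b₂ τ hb₁ hb₂ hτ hb₁τ hb₂τ hεb₁ hεb₂ => ?_⟩
  have hτ0 : 0 < τ := hb₁.trans_le hb₁τ
  have hK0 : 0 < K := by linarith
  set β := b₁ * b₂ / τ with hβ
  have hβ0 : 0 < β := by positivity
  have hβτ : β ≤ τ := by rw [hβ, div_le_iff₀ hτ0]; nlinarith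
  set n₁ : ℕ := ⌊K * τ / b₁⌋₊ with hn₁
  set n₂ : ℕ := ⌊K * τ / b₂⌋₊ with hn₂
  have hfloor : ∀ b : ℝ, 0 < b → b ≤ τ → ε * τ ≤ b →
      (⌊K * τ / b⌋₊ : ℝ) * b ≤ K * τ ∧ (K - 1) * τ ≤ (⌊K * τ / b⌋₊ : ℝ) * b ∧
        (⌊K * τ / b⌋₊ : ℝ) ≤ K / ε := by
    intro b hb hbτ hεb
    have h1 : (⌊K * τ / b⌋₊ : ℝ) ≤ K * τ / b := Nat.floor_le (by positivity)
    have h2 : K * τ / b < ⌊K * τ / b⌋₊ + 1 := Nat.lt_floor_add_one _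
    rw [div_lt_iff₀ hb] at h2
    refine ⟨(le_div_iff₀ hb).1 h1, by linarith, h1.trans ?_⟩
    rw [div_le_div_iff₀ hb hε]
    nlinarith
  obtain ⟨h₁a, h₁b, h₁c⟩ := hfloor b₁ hb₁ hb₁τ hεb₁
  obtain ⟨h₂a, h₂b, h₂c⟩ := hfloor b₂ hb₂ hb₂τ hεb₂
  rw [← hn₁] at h₁a h₁b h₁c
  rw [← hn₂] at h₂a h₂b h₂c
  let E₁ := Finset.range m₁ ×ˢ Finset.range n₂
  let E₂ := Finset.range n₁ ×ˢ Finset.range m₂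
  set M : ℝ := m₁ * n₂ + n₁ * m₂ with hM
  have hm₁' : (m₁ : ℝ) ≤ d := by exact_mod_cast hm₁
  have hm₂' : (m₂ : ℝ) ≤ d := by exact_mod_cast hm₂
  have hm₁0 : (0 : ℝ) ≤ m₁ := Nat.cast_nonneg _
  have hm₂0 : (0 : ℝ) ≤ m₂ := Nat.cast_nonneg _
  have hcardE : M - d ^ 2 ≤ ((E₁ ∪ E₂).card : ℝ) := by
    have h1 := Finset.card_union_add_card_inter E₁ E₂
    have h2 : E₁ ∩ E₂ ⊆ Finset.range m₁ ×ˢ Finset.range m₂ := by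
      intro e he
      simp only [E₁, E₂, Finset.mem_inter, Finset.mem_product] at he
      simp [he.1.1, he.2.2]
    have h3 := Finset.card_le_card h2
    simp only [Finset.card_product, Finset.card_range, E₁, E₂] at h1 h3
    have h4 : M = ((Finset.range m₁ ×ˢ Finset.range n₂ ∪ Finset.range n₁ ×ˢ Finset.range m₂).card :
        ℝ) + ((Finset.range m₁ ×ˢ Finset.range n₂) ∩ (Finset.range n₁ ×ˢ Finset.range m₂)).card := by
      rw [hM]; exact_mod_cast h1.symm
    have h5 : (((Finset.range m₁ ×ˢ Finset.range n₂) ∩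
        (Finset.range n₁ ×ˢ Finset.range m₂)).card : ℝ) ≤ m₁ * m₂ := by exact_mod_cast h3
    have h6 := mul_le_mul hm₁' hm₂' hm₂0 (Nat.cast_nonneg d)
    simp only [E₁, E₂]
    linarith
  have hβM : (K - 1) * τ ≤ β * M := by
    have h1 : (K - 1) * τ * τ ≤ b₁ * b₂ * M := by
      rw [hM]
      have h2 := mul_le_mul_of_nonneg_left h₂b (mul_nonneg hm₁0 hb₁.le)
      have h3 := mul_le_mul_of_nonneg_left h₁b (mul_nonneg hm₂0 hb₂.le)
      have h4 : (K - 1) * τ * τ = m₁ * b₁ * ((K - 1) * τ) + m₂ * b₂ * ((K - 1) * τ) := by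
        nth_rewrite 2 [hτ]; ring
      linarith
    rw [hβ, div_mul_eq_mul_div, le_div_iff₀ hτ0]
    exact h1
  have hM0 : K - 1 ≤ M := by
    have hMnn : 0 ≤ M := by positivity
    have : (K - 1) * τ ≤ M * τ := hβM.trans (by nlinarith)
    exact le_of_mul_le_mul_right this hτ0
  set s : ℝ := ((E₁ ∪ E₂).card : ℝ) with hs
  refine ⟨E₁ ∪ E₂, ?_, fun e he => ?_, fun e he => ?_, ?_⟩
  · have : (3 : ℝ) ≤ s := by linarith [sq_nonneg (d : ℝ)]
    rw [hs] at this
    exact_mod_cast this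
  · simp only [E₁, E₂, Finset.mem_union, Finset.mem_product, Finset.mem_range] at he
    exact he.imp And.left And.right
  · have : (e.1 : ℝ) + e.2 ≤ d + K / ε := by
      simp only [E₁, E₂, Finset.mem_union, Finset.mem_product, Finset.mem_range] at he
      rcases he with ⟨h1, h2⟩ | ⟨h1, h2⟩
      · have h1' : (e.1 : ℝ) ≤ m₁ := by exact_mod_cast h1.le
        have h2' : (e.2 : ℝ) ≤ n₂ := by exact_mod_cast h2.le
        linarith
      · have h1' : (e.1 : ℝ) ≤ n₁ := by exact_mod_cast h1.le
        have h2' : (e.2 : ℝ) ≤ m₂ := by exact_mod_cast h2.le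
        linarith
    exact_mod_cast this.trans (Nat.le_ceil _)
  · have hsum : ∑ e ∈ E₁ ∪ E₂, ((e.1 : ℝ) * b₁ + e.2 * b₂) ≤ M * (τ * (1 + K / 2)) := by
      have h0 : ∑ e ∈ E₁ ∪ E₂, ((e.1 : ℝ) * b₁ + e.2 * b₂) ≤
          ∑ e ∈ E₁, ((e.1 : ℝ) * b₁ + e.2 * b₂) + ∑ e ∈ E₂, ((e.1 : ℝ) * b₁ + e.2 * b₂) := by
        rw [← Finset.sum_union_inter]
        exact le_add_of_nonneg_right (Finset.sum_nonneg fun e _ => by positivity)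
      have h1 := sum_rectangle_weight_le m₁ n₂ hb₁.le hb₂.le
      have h2' : ∑ e ∈ E₂, ((e.1 : ℝ) * b₁ + e.2 * b₂) ≤ n₁ * m₂ * (m₂ * b₂ + n₁ * b₁ / 2) := by
        have h3 := sum_rectangle_weight_le m₂ n₁ hb₂.le hb₁.le
        have h4 : ∑ e ∈ E₂, ((e.1 : ℝ) * b₁ + e.2 * b₂) =
            ∑ e ∈ Finset.range m₂ ×ˢ Finset.range n₁, ((e.1 : ℝ) * b₂ + e.2 * b₁) := by
          rw [Finset.sum_product_right, Finset.sum_product]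
          exact Finset.sum_congr rfl fun i _ => Finset.sum_congr rfl fun j _ => add_comm _ _
        rw [h4]
        linarith
      have h3 : m₁ * b₁ + n₂ * b₂ / 2 ≤ τ * (1 + K / 2) := by linarith [mul_nonneg hm₂0 hb₂.le]
      have h4 : m₂ * b₂ + n₁ * b₁ / 2 ≤ τ * (1 + K / 2) := by linarith [mul_nonneg hm₁0 hb₁.le]
      have h5 := mul_le_mul_of_nonneg_left h3 (by positivity : (0 : ℝ) ≤ m₁ * n₂)
      have h6 := mul_le_mul_of_nonneg_left h4 (by positivity : (0 : ℝ) ≤ n₁ * m₂)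
      rw [hM]
      linarith
    refine hsum.trans ?_
    have h1 : M * (M - 2 * c) ≤ s * (s - 1) := by
      have h2 : M - c ≤ s := by linarith
      have h3 : M - c ≤ s - 1 := by linarith
      have h4 := mul_le_mul h2 h3 (by linarith) (by linarith)
      linarith [sq_nonneg c]
    have h2 : τ * (K + 2) ≤ (ε * τ + β) * (M - 2 * c) := by
      have h3 : ε * τ * (K - 1) ≤ ε * τ * M := mul_le_mul_of_nonneg_left hM0 (by positivity)
      have h4 : 2 * c * β ≤ 2 * c * τ := mul_le_mul_of_nonneg_left hβτ (by linarith)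
      have h5 : τ * (ε * (K - 1 - 2 * c)) = τ * (3 + 2 * c) := by rw [hKε]
      linarith
    have h3 := mul_le_mul_of_nonneg_left h2 (by linarith : 0 ≤ M)
    have h4 := mul_le_mul_of_nonneg_left h1 (by positivity : 0 ≤ ε * τ + β)
    linarith

end MonomialSet

section Counting

open MvPolynomial

/-- An `L`-shaped set of exponents, none of which is divisible by `m`, with small total weight
compared to the square of its cardinality. -/
theorem exists_exponent_finset (d : ℕ) {ε : ℝ} (hε : 0 < ε) :
    ∃ D : ℕ, ∀ m : Fin 2 →₀ ℕ, m 0 ≤ d → m 1 ≤ d → ∀ b₁ b₂ τ : ℝ, 0 < b₁ → 0 < b₂ →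
      τ = m 0 * b₁ + m 1 * b₂ → b₁ ≤ τ → b₂ ≤ τ → ε * τ ≤ b₁ → ε * τ ≤ b₂ →
      ∃ E : Finset (Fin 2 →₀ ℕ), 3 ≤ E.card ∧ (∀ e ∈ E, ¬ m ≤ e) ∧
        (∀ e ∈ E, e 0 + e 1 ≤ D) ∧
        ∑ e ∈ E, ((e 0 : ℝ) * b₁ + e 1 * b₂) ≤
          (ε * τ + b₁ * b₂ / τ) * (E.card * (E.card - 1) / 2) := by
  obtain ⟨D, hD⟩ := exists_exponent_pairs (d := d) hε
  refine ⟨D, fun m hm₀ hm₁ b₁ b₂ τ h₁ h₂ h₃ h₄ h₅ h₆ h₇ => ?_⟩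
  obtain ⟨E, hE₁, hE₂, hE₃, hE₄⟩ := hD _ _ hm₀ hm₁ b₁ b₂ τ h₁ h₂ h₃ h₄ h₅ h₆ h₇
  let f : ℕ × ℕ ≃ (Fin 2 →₀ ℕ) := (finTwoArrowEquiv ℕ).symm.trans Finsupp.equivFunOnFinite.symm
  have hf0 : ∀ e, f e 0 = e.1 := fun e => by simp [f]
  have hf1 : ∀ e, f e 1 = e.2 := fun e => by simp [f]
  refine ⟨E.map f.toEmbedding, by simpa using hE₁, ?_, ?_, ?_⟩
  · simp only [Finset.mem_map, Equiv.coe_toEmbedding]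
    rintro _ ⟨e, he, rfl⟩ hle
    have h0 := hle 0
    have h1 := hle 1
    rw [hf0] at h0
    rw [hf1] at h1
    rcases hE₂ e he with h | h <;> omega
  · simp only [Finset.mem_map, Equiv.coe_toEmbedding]
    rintro _ ⟨e, he, rfl⟩
    rw [hf0, hf1]
    exact hE₃ e he
  · simpa [Finset.sum_map, hf0, hf1] using hE₄

theorem sum_fin_sub_mul_two (s : ℕ) : (∑ k : Fin s, (s - (k : ℕ))) * 2 = s * (s + 1) := by
  rw [Fin.sum_univ_eq_sum_range (fun k => s - k) s]
  have h := Finset.sum_range_reflect (fun k => s - k) s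
  rw [← h]
  have h2 : ∑ j ∈ Finset.range s, (s - (s - 1 - j)) = ∑ j ∈ Finset.range s, (j + 1) :=
    Finset.sum_congr rfl fun j hj => by have := Finset.mem_range.1 hj; omega
  rw [h2, Finset.sum_add_distrib, add_mul, Finset.sum_range_id_mul_two]
  rcases s with _ | s
  · simp
  · simp; ring

/-- The size condition of `exists_auxiliary_polynomial` holds for large primes. -/
theorem pow_sum_mul_prod_le {ι : Type*} (E : Finset ι) (w : ι → ℝ) {A x : ℝ} (hx : 0 < x)
    (hE : 3 ≤ E.card) (hw : ∑ e ∈ E, w e ≤ A * (E.card * (E.card - 1) / 2))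
    (hlog : 6 + A ≤ Real.log x) :
    x ^ (∑ k : Fin E.card, (E.card - (k : ℕ))) *
      ((2 * E.card : ℝ) ^ E.card * ∏ e ∈ E, Real.exp (w e)) ≤ x ^ (E.card * E.card) := by
  set s := E.card with hs
  have h2 := sum_fin_sub_mul_two s
  set N := ∑ k : Fin s, (s - (k : ℕ)) with hN
  obtain ⟨N', hN'⟩ : ∃ N', s * s = N + N' := Nat.exists_eq_add_of_le (by nlinarith)
  have hN'2 : (N' : ℝ) = s * (s - 1) / 2 := by
    have h3 : (N : ℝ) * 2 = s * (s + 1) := by exact_mod_cast h2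
    have h4 : (s * s : ℝ) = N + N' := by exact_mod_cast hN'
    linarith
  have hs3 : (3 : ℝ) ≤ s := by exact_mod_cast hE
  rw [hN', pow_add]
  refine mul_le_mul_of_nonneg_left ?_ (by positivity)
  rw [← Real.exp_sum]
  have h5 : (2 * s : ℝ) ^ s ≤ Real.exp (s * (2 * s)) := by
    rw [Real.exp_nat_mul]
    exact pow_le_pow_left₀ (by positivity) ((Real.add_one_le_exp _).trans' (by linarith)) _
  calc (2 * s : ℝ) ^ s * Real.exp (∑ e ∈ E, w e)
      ≤ Real.exp (s * (2 * s)) * Real.exp (∑ e ∈ E, w e) := by gcongr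
    _ = Real.exp (s * (2 * s) + ∑ e ∈ E, w e) := (Real.exp_add _ _).symm
    _ ≤ Real.exp (N' * Real.log x) := by
        refine Real.exp_le_exp.2 ?_
        have h6 : (0 : ℝ) ≤ N' := Nat.cast_nonneg _
        have h7 := mul_le_mul_of_nonneg_left hlog h6
        rw [← hN'2] at hw
        nlinarith
    _ = x ^ N' := by rw [Real.exp_nat_mul, Real.exp_log hx]

theorem MvPolynomial.totalDegree_map_le {R S σ : Type*} [CommSemiring R] [CommSemiring S]
    (f : R →+* S) (F : MvPolynomial σ R) : (map f F).totalDegree ≤ F.totalDegree :=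
  Finset.sup_mono (support_map_subset f F)

theorem MvPolynomial.eval_map_intCast {σ R : Type*} [CommRing R] (F : MvPolynomial σ ℤ)
    (v : σ → ℤ) : eval (fun k => (v k : R)) (map (Int.castRingHom R) F) = (eval v F : ℤ) := by
  have h := eval₂_comp_left (Int.castRingHom R) (RingHom.id ℤ) v F
  rw [RingHom.comp_id] at h
  rw [eval_map]
  exact h.symm

/-- Two integral polynomials in two variables, the first irreducible and not dividing the second,
have few common integral zeros. -/
theorem MvPolynomial.card_common_int_zeros_le {F G : MvPolynomial (Fin 2) ℤ}
    (hF : Irreducible (map (Int.castRingHom ℚ) F))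
    (h0 : (map (Int.castRingHom ℚ) F).degreeOf 0 ≠ 0)
    (hFG : ¬ map (Int.castRingHom ℚ) F ∣ map (Int.castRingHom ℚ) G) {d D : ℕ}
    (hd : F.totalDegree ≤ d) (hD : G.totalDegree ≤ D) (S : Finset (Fin 2 → ℤ))
    (hSF : ∀ v ∈ S, eval v F = 0) (hSG : ∀ v ∈ S, eval v G = 0) :
    S.card ≤ d * (d + D) ^ 2 := by
  classical
  let c : (Fin 2 → ℤ) → (Fin 2 → ℚ) := fun v k => (v k : ℚ)
  have hc : Function.Injective c := by
    intro v w h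
    funext k
    simpa [c] using congrFun h k
  have hev : ∀ (H : MvPolynomial (Fin 2) ℤ) v, eval v H = 0 →
      eval (c v) (map (Int.castRingHom ℚ) H) = 0 := fun H v h => by
    rw [eval_map_intCast, h, Int.cast_zero]
  have h := card_common_zeros_le hF h0 hFG (S.image c)
    (by simp only [Finset.mem_image]; rintro _ ⟨v, hv, rfl⟩; exact hev F v (hSF v hv))
    (by simp only [Finset.mem_image]; rintro _ ⟨v, hv, rfl⟩; exact hev G v (hSG v hv))
  rw [Finset.card_image_of_injective _ hc] at h
  have hmap : ∀ H : MvPolynomial (Fin 2) ℤ,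
      (map (Int.castRingHom ℚ) H).totalDegree ≤ H.totalDegree := fun H => totalDegree_map_le ..
  have hd' := (hmap F).trans hd
  have hD' := (hmap G).trans hD
  exact h.trans (Nat.mul_le_mul hd' (Nat.pow_le_pow_left (Nat.add_le_add hd' hD') 2))

end Counting

section Primes

open MvPolynomial

/-- Integral points at which a partial derivative is not divisible by `p` lie in few residue
classes modulo `p`, so there are not many of them if each class contains few. -/
theorem MvPolynomial.card_le_mul_of_residue_classes {p : ℕ} (hp : p.Prime)
    (F : MvPolynomial (Fin 2) ℤ) {d R : ℕ} (hd : F.totalDegree ≤ d) (S : Finset (Fin 2 → ℤ))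
    (hS : ∀ v ∈ S, eval v F = 0) (hS' : ∀ v ∈ S, ¬ (p : ℤ) ∣ eval v (pderiv 1 F))
    (hR : ∀ v₀ ∈ S, ∀ S' ⊆ S, (∀ v ∈ S', ∀ k, (p : ℤ) ∣ v k - v₀ k) → S'.card ≤ R) :
    S.card ≤ R * (p * d) := by
  classical
  have : Fact p.Prime := ⟨hp⟩
  let c : (Fin 2 → ℤ) → (Fin 2 → ZMod p) := fun v k => (v k : ZMod p)
  have h1 : S.card ≤ R * (S.image c).card := by
    refine Finset.card_le_mul_card_image S R fun b hb => ?_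
    obtain ⟨v₀, hv₀, rfl⟩ := Finset.mem_image.1 hb
    refine hR v₀ hv₀ _ (Finset.filter_subset _ _) fun v hv k => ?_
    have h := congrFun (Finset.mem_filter.1 hv).2 k
    rw [← ZMod.intCast_zmod_eq_zero_iff_dvd]
    push_cast
    rw [sub_eq_zero]
    exact h
  have h2 : (S.image c).card ≤ p * d := by
    have h3 := Finset.card_le_mul_card_image (f := fun w : Fin 2 → ZMod p => w 0) (S.image c) d
      fun b _ => by
        refine (card_le_totalDegree_of_pderiv_ne_zero (i := 0) (j := 1) (by decide)
          (F := map (Int.castRingHom (ZMod p)) F) (a := b) _ ?_ ?_ ?_).trans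
          ((totalDegree_map_le ..).trans hd)
        · intro w hw
          exact (Finset.mem_filter.1 hw).2
        · intro w hw
          obtain ⟨v, hv, rfl⟩ := Finset.mem_image.1 (Finset.mem_filter.1 hw).1
          rw [eval_map_intCast, hS v hv, Int.cast_zero]
        · intro w hw
          obtain ⟨v, hv, rfl⟩ := Finset.mem_image.1 (Finset.mem_filter.1 hw).1
          rw [pderiv_map, eval_map_intCast, Ne, ZMod.intCast_zmod_eq_zero_iff_dvd]
          exact hS' v hv
    refine h3.trans ?_
    rw [mul_comm]
    refine Nat.mul_le_mul_right _ ((Finset.card_le_univ _).trans_eq ?_)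
    exact ZMod.card p
  exact h1.trans (Nat.mul_le_mul_left _ h2)

/-- There are at least `k` primes between `n` and `2 ^ k * n`. -/
theorem exists_finset_primes (k : ℕ) {n : ℕ} (hn : n ≠ 0) :
    ∃ P : Finset ℕ, P.card = k ∧ ∀ p ∈ P, p.Prime ∧ n < p ∧ p ≤ 2 ^ k * n := by
  induction k with
  | zero => exact ⟨∅, by simp, by simp⟩
  | succ k ih =>
    obtain ⟨P, hP, hP'⟩ := ih
    obtain ⟨q, hq, hq₁, hq₂⟩ := Nat.exists_prime_lt_and_le_two_mul (2 ^ k * n) (by positivity)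
    have hqP : q ∉ P := fun h => absurd (hP' q h).2.2 (by omega)
    have hk : n ≤ 2 ^ k * n := Nat.le_mul_of_pos_left n (by positivity)
    refine ⟨insert q P, by rw [Finset.card_insert_of_notMem hqP, hP], fun p hp => ?_⟩
    rcases Finset.mem_insert.1 hp with rfl | hp
    · refine ⟨hq, by omega, ?_⟩
      rw [pow_succ]
      linarith
    · obtain ⟨h1, h2, h3⟩ := hP' p hp
      refine ⟨h1, h2, ?_⟩
      rw [pow_succ]
      linarith

/-- A nonzero integer of size at most `n ^ k` is not divisible by all of `k` primes greater
than `n`. -/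
theorem exists_prime_not_dvd {P : Finset ℕ} {n : ℕ} (hP : ∀ p ∈ P, p.Prime ∧ n < p)
    {a : ℤ} (ha : a ≠ 0) (han : a.natAbs < n ^ P.card) : ∃ p ∈ P, ¬ (p : ℤ) ∣ a := by
  by_contra! h
  have h1 : ∏ p ∈ P, p ∣ a.natAbs := by
    refine Finset.prod_primes_dvd _ (fun p hp => (hP p hp).1.prime) fun p hp => ?_
    exact Int.natCast_dvd.1 (h p hp)
  have h2 := Nat.le_of_dvd (Int.natAbs_pos.2 ha) h1
  have h3 : n ^ P.card ≤ ∏ p ∈ P, p := by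
    rw [← Finset.prod_const]
    exact Finset.prod_le_prod' fun p hp => (hP p hp).2.le
  omega

end Primes

section Derivative

open MvPolynomial

theorem abs_pow_mul_pow_le_exp {x y b₁ b₂ : ℝ} (hx : |x| ≤ Real.exp b₁) (hy : |y| ≤ Real.exp b₂)
    (m n : ℕ) : |x ^ m * y ^ n| ≤ Real.exp (m * b₁ + n * b₂) := by
  rw [abs_mul, abs_pow, abs_pow, Real.exp_add, Real.exp_nat_mul, Real.exp_nat_mul]
  gcongr

theorem MvPolynomial.apply_le_totalDegree {R σ : Type*} [CommSemiring R] {F : MvPolynomial σ R}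
    {e : σ →₀ ℕ} (he : e ∈ F.support) (k : σ) : e k ≤ F.totalDegree :=
  (monomial_le_degreeOf k he).trans (degreeOf_le_totalDegree F k)

theorem MvPolynomial.add_le_totalDegree {R : Type*} [CommSemiring R] {F : MvPolynomial (Fin 2) R}
    {e : Fin 2 →₀ ℕ} (he : e ∈ F.support) : e 0 + e 1 ≤ F.totalDegree := by
  have h := le_totalDegree he
  rwa [Finsupp.sum_fintype _ _ fun _ => rfl, Fin.sum_univ_two] at h

theorem MvPolynomial.totalDegree_le_of_forall {R : Type*} [CommSemiring R]
    {F : MvPolynomial (Fin 2) R} {D : ℕ} (h : ∀ e ∈ F.support, e 0 + e 1 ≤ D) :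
    F.totalDegree ≤ D := by
  refine Finset.sup_le fun e he => ?_
  rw [Finsupp.sum_fintype _ _ fun _ => rfl, Fin.sum_univ_two]
  exact h e he

theorem MvPolynomial.card_support_le {R : Type*} [CommSemiring R] {F : MvPolynomial (Fin 2) R}
    {d : ℕ} (hd : F.totalDegree ≤ d) : F.support.card ≤ (d + 1) ^ 2 := by
  have h := Finset.card_le_card_of_injOn (s := F.support) (fun e : Fin 2 →₀ ℕ => (e 0, e 1))
    (t := Finset.range (d + 1) ×ˢ Finset.range (d + 1)) ?_ ?_
  · simpa [sq] using h
  · intro e he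
    have h0 := (apply_le_totalDegree he 0).trans hd
    have h1 := (apply_le_totalDegree he 1).trans hd
    simp only [Finset.coe_product, Finset.coe_range, Set.mem_prod, Set.mem_Iio]
    omega
  · intro e _ e' _ h
    simp only [Prod.mk.injEq] at h
    ext k
    fin_cases k
    · exact h.1
    · exact h.2

theorem MvPolynomial.add_single_mem_support_of_mem_support_pderiv {R σ : Type*} [CommSemiring R]
    {F : MvPolynomial σ R} {j : σ} {e : σ →₀ ℕ} (he : e ∈ (pderiv j F).support) :
    e + Finsupp.single j 1 ∈ F.support := by
  rw [mem_support_iff, coeff_pderiv] at he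
  exact mem_support_iff.2 (left_ne_zero_of_mul he)

theorem MvPolynomial.totalDegree_pderiv_le {R : Type*} [CommSemiring R]
    (F : MvPolynomial (Fin 2) R) (j : Fin 2) : (pderiv j F).totalDegree ≤ F.totalDegree := by
  refine totalDegree_le_of_forall fun e he => ?_
  have h := add_le_totalDegree (add_single_mem_support_of_mem_support_pderiv he)
  simp only [Finsupp.add_apply] at h
  omega

/-- A polynomial depending on a variable does not divide its derivative in characteristic zero. -/
theorem MvPolynomial.not_dvd_pderiv_one {K : Type*} [Field K] [CharZero K]
    {F : MvPolynomial (Fin 2) K} (hF : F.degreeOf 1 ≠ 0) : ¬ F ∣ pderiv 1 F := by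
  have hF0 : F ≠ 0 := by rintro rfl; simp at hF
  intro hdvd
  obtain ⟨m, -, hmax, hm⟩ := exists_max_weight_le_support_mul hF0 0 1
  have hne : pderiv 1 F ≠ 0 := by
    intro h
    refine hF ?_
    rw [← Nat.le_zero, degreeOf_eq_sup]
    refine Finset.sup_le fun e he => ?_
    by_contra! h0
    have h2 : e - Finsupp.single 1 1 + Finsupp.single 1 1 = e :=
      tsub_add_cancel_of_le (by simpa using Nat.succ_le_of_lt h0)
    have h3 := coeff_pderiv F (e - Finsupp.single 1 1) (i := 1)
    rw [h, coeff_zero, h2] at h3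
    rcases mul_eq_zero.1 h3.symm with h4 | h4
    · exact mem_support_iff.1 he h4
    · exact Nat.cast_add_one_ne_zero _ h4
  obtain ⟨e, he, hle⟩ := hm _ hne hdvd
  have h1 := hmax _ (add_single_mem_support_of_mem_support_pderiv he)
  have h2 : e 1 + 1 ≤ m 1 := by
    simp only [Finsupp.add_apply, Finsupp.single_eq_same, mul_zero, mul_one, zero_add] at h1
    exact_mod_cast h1
  have h3 := hle 1
  omega

/-- A bound for the values of a derivative in terms of the size of the coefficients and of the
monomials. -/
theorem MvPolynomial.abs_eval_pderiv_one_le {F : MvPolynomial (Fin 2) ℤ} {d : ℕ}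
    (hd : F.totalDegree ≤ d) {b₁ b₂ τ H : ℝ} (hb₂ : 0 ≤ b₂)
    (hτ : ∀ e ∈ F.support, e 0 * b₁ + e 1 * b₂ ≤ τ) (hH : ∀ e, |((coeff e F : ℤ) : ℝ)| ≤ H)
    {v : Fin 2 → ℤ} (hv₀ : |(v 0 : ℝ)| ≤ Real.exp b₁) (hv₁ : |(v 1 : ℝ)| ≤ Real.exp b₂) :
    |((eval v (pderiv 1 F) : ℤ) : ℝ)| ≤ (d + 1 : ℝ) ^ 2 * (H * d * Real.exp τ) := by
  have hH0 : 0 ≤ H := (abs_nonneg _).trans (hH 0)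
  rw [eval_eq']
  push_cast
  have h1 : ∀ e ∈ (pderiv 1 F).support, |((coeff e (pderiv 1 F) : ℤ) : ℝ) *
      ∏ i, (v i : ℝ) ^ e i| ≤ H * d * Real.exp τ := by
    intro e he
    have he' := add_single_mem_support_of_mem_support_pderiv he
    have h2 := apply_le_totalDegree he' 1
    have h3 := hτ _ he'
    simp only [Finsupp.add_apply, Finsupp.single_eq_same] at h2 h3
    have h2' : (e 1 : ℝ) + 1 ≤ d := by exact_mod_cast h2.trans hd
    rw [coeff_pderiv, Fin.prod_univ_two, abs_mul]
    push_cast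
    rw [abs_mul, abs_of_nonneg (by positivity : (0 : ℝ) ≤ e 1 + 1)]
    refine mul_le_mul (mul_le_mul (hH _) h2' (by positivity) hH0) ?_ (abs_nonneg _) (by positivity)
    refine (abs_pow_mul_pow_le_exp hv₀ hv₁ _ _).trans (Real.exp_le_exp.2 ?_)
    simp at h3
    linarith
  refine (Finset.abs_sum_le_sum_abs _ _).trans ((Finset.sum_le_card_nsmul _ _ _ h1).trans ?_)
  rw [nsmul_eq_mul]
  refine mul_le_mul_of_nonneg_right ?_ (by positivity)
  exact_mod_cast card_support_le ((totalDegree_pderiv_le F 1).trans hd)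

end Derivative

section Generic

open MvPolynomial

/-- Few integral zeros of an irreducible polynomial in a box are congruent to each other modulo
a large prime. -/
theorem card_le_of_congruent {F : MvPolynomial (Fin 2) ℤ}
    (hF : Irreducible (map (Int.castRingHom ℚ) F))
    (h0 : (map (Int.castRingHom ℚ) F).degreeOf 0 ≠ 0) {d D : ℕ} (hd : F.totalDegree ≤ d)
    {m : Fin 2 →₀ ℕ}
    (hm : ∀ G, G ≠ 0 → map (Int.castRingHom ℚ) F ∣ G → ∃ e ∈ G.support, m ≤ e)
    {E : Finset (Fin 2 →₀ ℕ)} (hE : 3 ≤ E.card) (hEm : ∀ e ∈ E, ¬ m ≤ e)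
    (hED : ∀ e ∈ E, e 0 + e 1 ≤ D) {b₁ b₂ A : ℝ}
    (hEw : ∑ e ∈ E, ((e 0 : ℝ) * b₁ + e 1 * b₂) ≤ A * (E.card * (E.card - 1) / 2))
    {p : ℕ} (hp : p.Prime) (hlog : 6 + A ≤ Real.log p) {v₀ : Fin 2 → ℤ}
    (hv₀ : ¬ (p : ℤ) ∣ eval v₀ (pderiv 1 F)) (S : Finset (Fin 2 → ℤ))
    (hS : ∀ v ∈ S, eval v F = 0)
    (hbox : ∀ v ∈ S, |(v 0 : ℝ)| ≤ Real.exp b₁ ∧ |(v 1 : ℝ)| ≤ Real.exp b₂)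
    (hcong : ∀ v ∈ S, ∀ k, (p : ℤ) ∣ v k - v₀ k) : S.card ≤ d * (d + D) ^ 2 := by
  obtain ⟨G, hG, hGE, hGS⟩ := exists_auxiliary_polynomial hp (S := (S : Set (Fin 2 → ℤ)))
    (fun v hv => hS v hv) hv₀ (fun v hv => hcong v hv) E (Finset.card_pos.1 (by omega))
    (fun e => Real.exp (e 0 * b₁ + e 1 * b₂)) (fun e _ => Real.exp_pos _)
    (fun v hv e _ => abs_pow_mul_pow_le_exp (hbox v hv).1 (hbox v hv).2 _ _)
    (pow_sum_mul_prod_le E _ (by exact_mod_cast hp.pos) hE hEw hlog)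
  refine card_common_int_zeros_le hF h0 (G := G) (fun hdvd => ?_) hd
    (totalDegree_le_of_forall fun e he => hED e (hGE he)) S hS fun v hv => hGS v hv
  have hG' : map (Int.castRingHom ℚ) G ≠ 0 := by
    rwa [Ne, map_eq_zero_iff _ (map_injective _ Int.cast_injective)]
  obtain ⟨e, he, hle⟩ := hm _ hG' hdvd
  exact hEm e (hGE (support_map_subset _ _ he)) hle

/-- Integral zeros at which the derivative is nonzero, counted with the help of a finite set of
primes. -/
theorem card_le_of_primes {F : MvPolynomial (Fin 2) ℤ} {d R n N : ℕ} (hd : F.totalDegree ≤ d)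
    {P : Finset ℕ} (hP : ∀ p ∈ P, p.Prime ∧ n < p ∧ p ≤ N) (S : Finset (Fin 2 → ℤ))
    (hS : ∀ v ∈ S, eval v F = 0) (hS' : ∀ v ∈ S, eval v (pderiv 1 F) ≠ 0)
    (hn : ∀ v ∈ S, (eval v (pderiv 1 F)).natAbs < n ^ P.card)
    (hR : ∀ p ∈ P, ∀ v₀ ∈ S, ¬ (p : ℤ) ∣ eval v₀ (pderiv 1 F) → ∀ S' ⊆ S,
      (∀ v ∈ S', ∀ k, (p : ℤ) ∣ v k - v₀ k) → S'.card ≤ R) :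
    S.card ≤ P.card * (R * (N * d)) := by
  classical
  have h1 : S ⊆ P.biUnion fun p => S.filter fun v => ¬ (p : ℤ) ∣ eval v (pderiv 1 F) := by
    intro v hv
    obtain ⟨p, hp, hpv⟩ := exists_prime_not_dvd (fun p hp => ⟨(hP p hp).1, (hP p hp).2.1⟩)
      (hS' v hv) (hn v hv)
    exact Finset.mem_biUnion.2 ⟨p, hp, Finset.mem_filter.2 ⟨hv, hpv⟩⟩
  refine (Finset.card_le_card h1).trans (Finset.card_biUnion_le_card_mul _ _ _ fun p hp => ?_)
  refine (card_le_mul_of_residue_classes (hP p hp).1 F hd _ ?_ ?_ (R := R) ?_).trans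
    (Nat.mul_le_mul_left _ (Nat.mul_le_mul_right _ (hP p hp).2.2))
  · exact fun v hv => hS v (Finset.mem_filter.1 hv).1
  · exact fun v hv => (Finset.mem_filter.1 hv).2
  · exact fun v₀ hv₀ S' hS' => hR p hp v₀ (Finset.mem_filter.1 hv₀).1 (Finset.mem_filter.1 hv₀).2 S'
      (hS'.trans (Finset.filter_subset _ _))

/-- Integral zeros in a not too lopsided box of an irreducible polynomial of bounded height. -/
theorem exists_card_le_of_height_le (d : ℕ) {ε : ℝ} (hε : 0 < ε) :
    ∃ c : ℝ, 0 < c ∧ ∀ F : MvPolynomial (Fin 2) ℤ, F.totalDegree ≤ d →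
      Irreducible (map (Int.castRingHom ℚ) F) →
      (map (Int.castRingHom ℚ) F).degreeOf 0 ≠ 0 → (map (Int.castRingHom ℚ) F).degreeOf 1 ≠ 0 →
      ∀ b₁ b₂ τ : ℝ, 0 < b₁ → 0 < b₂ → (∀ e ∈ F.support, e 0 * b₁ + e 1 * b₂ ≤ τ) →
      (∃ e ∈ F.support, τ = e 0 * b₁ + e 1 * b₂) → b₁ ≤ τ → b₂ ≤ τ → ε * τ ≤ b₁ → ε * τ ≤ b₂ →
      (∀ e, |((coeff e F : ℤ) : ℝ)| ≤ ((d + 1 : ℝ) ^ 2 * Real.exp τ) ^ (d + 1) ^ 2) →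
      ∀ S : Finset (Fin 2 → ℤ), (∀ v ∈ S, eval v F = 0) →
      (∀ v ∈ S, |(v 0 : ℝ)| ≤ Real.exp b₁ ∧ |(v 1 : ℝ)| ≤ Real.exp b₂) →
      (S.card : ℝ) ≤ c * Real.exp (ε * τ + b₁ * b₂ / τ) := by
  classical
  obtain ⟨D, hD⟩ := exists_exponent_finset d hε
  set n₀ : ℕ := (d + 1) ^ 2 with hn₀
  set a : ℝ := 6 + (n₀ : ℝ) ^ (n₀ + 1) * d with ha
  set k : ℕ := ⌈(n₀ + 1) / ε⌉₊ + 1 with hk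
  set R : ℕ := d * (d + D) ^ 2 with hR
  refine ⟨d * (d + d) ^ 2 + k * (R * (2 ^ k * (2 * Real.exp a) * d)) + 1, by positivity, ?_⟩
  intro F hd hF h0 h1 b₁ b₂ τ hb₁ hb₂ hτ hτ' hb₁τ hb₂τ hεb₁ hεb₂ hH S hS hbox
  have hτ0 : 0 < τ := hb₁.trans_le hb₁τ
  set β := b₁ * b₂ / τ with hβ
  have hβ0 : 0 < β := by positivity
  have ha6 : 6 ≤ a := by rw [ha]; exact le_add_of_nonneg_right (by positivity)
  have hεk : (n₀ : ℝ) + 1 ≤ k * ε := by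
    rw [← div_le_iff₀ hε, hk]
    push_cast
    linarith [Nat.le_ceil ((n₀ + 1 : ℝ) / ε)]
  set n : ℕ := ⌈Real.exp (a + (ε * τ + β))⌉₊ with hn
  have hnl : Real.exp (a + (ε * τ + β)) ≤ n := Nat.le_ceil _
  have hn0 : n ≠ 0 := by
    have : (0 : ℝ) < n := (Real.exp_pos _).trans_le hnl
    exact_mod_cast this.ne'
  have hnu : (n : ℝ) ≤ 2 * Real.exp a * Real.exp (ε * τ + β) := by
    rw [mul_assoc, ← Real.exp_add]
    have h2 := (Nat.ceil_lt_add_one (Real.exp_pos (a + (ε * τ + β))).le).le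
    have h3 : 1 ≤ Real.exp (a + (ε * τ + β)) := Real.one_le_exp (by positivity)
    linarith
  obtain ⟨P, hPk, hP⟩ := exists_finset_primes k hn0
  have hFinj : (map (Int.castRingHom ℚ) F).support = F.support :=
    support_map_of_injective F Int.cast_injective
  obtain ⟨m, hmF, hmax, hm⟩ := exists_max_weight_le_support_mul hF.ne_zero b₁ b₂
  rw [hFinj] at hmF hmax
  have hmτ : τ = m 0 * b₁ + m 1 * b₂ := by
    obtain ⟨e, he, h⟩ := hτ'
    exact le_antisymm (h.trans_le (hmax e he)) (hτ m hmF)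
  obtain ⟨E, hE, hEm, hED, hEw⟩ := hD m ((apply_le_totalDegree hmF 0).trans hd)
    ((apply_le_totalDegree hmF 1).trans hd) b₁ b₂ τ hb₁ hb₂ hmτ hb₁τ hb₂τ hεb₁ hεb₂
  have hsing : (S.filter fun v => eval v (pderiv 1 F) = 0).card ≤ d * (d + d) ^ 2 := by
    refine card_common_int_zeros_le hF h0 (G := pderiv 1 F) ?_ hd
      ((totalDegree_pderiv_le F 1).trans hd) _ (fun v hv => hS v (Finset.mem_filter.1 hv).1)
      (fun v hv => (Finset.mem_filter.1 hv).2)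
    rw [← pderiv_map]
    exact not_dvd_pderiv_one h1
  have hreg : (S.filter fun v => ¬ eval v (pderiv 1 F) = 0).card ≤
      k * (R * (2 ^ k * n * d)) := by
    rw [← hPk]
    nth_rewrite 2 [hPk]
    refine card_le_of_primes hd hP _ (fun v hv => hS v (Finset.mem_filter.1 hv).1)
      (fun v hv => (Finset.mem_filter.1 hv).2) ?_ ?_
    · intro v hv
      have hv' := (Finset.mem_filter.1 hv).1
      have h2 := abs_eval_pderiv_one_le hd hb₂.le hτ hH (hbox v hv').1 (hbox v hv').2
      have h3 : ((eval v (pderiv 1 F)).natAbs : ℝ) < (n : ℝ) ^ P.card := by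
        rw [Nat.cast_natAbs, Int.cast_abs, hPk]
        refine h2.trans_lt (lt_of_lt_of_le ?_ (pow_le_pow_left₀ (Real.exp_pos _).le hnl k))
        rw [← Real.exp_nat_mul]
        have h4 : (d + 1 : ℝ) ^ 2 * (((d + 1 : ℝ) ^ 2 * Real.exp τ) ^ n₀ * d * Real.exp τ) =
            (n₀ : ℝ) ^ (n₀ + 1) * d * Real.exp ((n₀ + 1 : ℕ) * τ) := by
          have h5 : (d + 1 : ℝ) ^ 2 = n₀ := by rw [hn₀]; push_cast; rfl
          rw [Real.exp_nat_mul, h5]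
          ring
        rw [h4]
        calc (n₀ : ℝ) ^ (n₀ + 1) * d * Real.exp ((n₀ + 1 : ℕ) * τ)
            < Real.exp a * Real.exp ((n₀ + 1 : ℕ) * τ) := by
              refine mul_lt_mul_of_pos_right ?_ (Real.exp_pos _)
              linarith [Real.add_one_le_exp a]
          _ = Real.exp (a + (n₀ + 1 : ℕ) * τ) := (Real.exp_add _ _).symm
          _ ≤ Real.exp (k * (a + (ε * τ + β))) := by
              refine Real.exp_le_exp.2 ?_
              have hk1 : (1 : ℝ) ≤ k := by exact_mod_cast Nat.le_add_left 1 _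
              have h5 := mul_le_mul_of_nonneg_right hεk hτ0.le
              have h6 := mul_le_mul_of_nonneg_right hk1 (by linarith : 0 ≤ a)
              have h7 : 0 ≤ k * β := by positivity
              push_cast
              linarith
      exact_mod_cast h3
    · intro p hp v₀ _ hpv S' hS' hcong
      have hsub : ∀ v ∈ S', v ∈ S := fun v hv => (Finset.mem_filter.1 (hS' hv)).1
      refine card_le_of_congruent hF h0 hd hm hE hEm hED hEw (hP p hp).1 ?_ hpv S'
        (fun v hv => hS v (hsub v hv)) (fun v hv => hbox v (hsub v hv)) hcong
      rw [Real.le_log_iff_exp_le (by exact_mod_cast (hP p hp).1.pos)]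
      have hnp : (n : ℝ) ≤ p := by exact_mod_cast (hP p hp).2.1.le
      exact (Real.exp_le_exp.2 (by linarith)).trans (hnl.trans hnp)
  have hcard : S.card ≤ d * (d + d) ^ 2 + k * (R * (2 ^ k * n * d)) := by
    rw [← Finset.card_filter_add_card_filter_not (s := S) (fun v => eval v (pderiv 1 F) = 0)]
    exact Nat.add_le_add hsing hreg
  have hexp : 1 ≤ Real.exp (ε * τ + β) := Real.one_le_exp (by positivity)
  calc (S.card : ℝ) ≤ d * (d + d) ^ 2 + k * (R * (2 ^ k * n * d)) := by exact_mod_cast hcard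
    _ ≤ d * (d + d) ^ 2 * Real.exp (ε * τ + β) +
        k * (R * (2 ^ k * (2 * Real.exp a * Real.exp (ε * τ + β)) * d)) := by
        refine add_le_add (le_mul_of_one_le_right (by positivity) hexp) ?_
        gcongr
    _ ≤ _ := by
        have := Real.exp_pos (ε * τ + β)
        nlinarith

end Generic

section Assembly

open MvPolynomial

/-- Integral zeros in a not too lopsided box of an irreducible polynomial. -/
theorem exists_card_le_of_exponent_le (d : ℕ) {ε : ℝ} (hε : 0 < ε) :
    ∃ c : ℝ, 0 < c ∧ ∀ F : MvPolynomial (Fin 2) ℤ, F.totalDegree ≤ d →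
      Irreducible (map (Int.castRingHom ℚ) F) →
      (map (Int.castRingHom ℚ) F).degreeOf 0 ≠ 0 → (map (Int.castRingHom ℚ) F).degreeOf 1 ≠ 0 →
      ∀ b₁ b₂ τ : ℝ, 0 < b₁ → 0 < b₂ → (∀ e ∈ F.support, e 0 * b₁ + e 1 * b₂ ≤ τ) →
      (∃ e ∈ F.support, τ = e 0 * b₁ + e 1 * b₂) → b₁ ≤ τ → b₂ ≤ τ → ε * τ ≤ b₁ → ε * τ ≤ b₂ →
      ∀ S : Finset (Fin 2 → ℤ), (∀ v ∈ S, eval v F = 0) →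
      (∀ v ∈ S, |(v 0 : ℝ)| ≤ Real.exp b₁ ∧ |(v 1 : ℝ)| ≤ Real.exp b₂) →
      (S.card : ℝ) ≤ c * Real.exp (ε * τ + b₁ * b₂ / τ) := by
  obtain ⟨c, hc, hC⟩ := exists_card_le_of_height_le d hε
  refine ⟨c + d * (d + d) ^ 2, by positivity, ?_⟩
  intro F hd hF h0 h1 b₁ b₂ τ hb₁ hb₂ hτ hτ' hb₁τ hb₂τ hεb₁ hεb₂ S hS hbox
  have hτ0 : 0 < τ := hb₁.trans_le hb₁τ
  have hinj : Function.Injective (map (σ := Fin 2) (Int.castRingHom ℚ)) :=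
    map_injective _ Int.cast_injective
  have hsupp : ∀ H : MvPolynomial (Fin 2) ℤ, (map (Int.castRingHom ℚ) H).support = H.support :=
    fun H => support_map_of_injective H Int.cast_injective
  have hF0 : F ≠ 0 := fun h => hF.ne_zero (by rw [h, map_zero])
  obtain ⟨G, hG, hGF, hGS, hGc⟩ := exists_small_height hF0 S hS (Real.one_le_exp hτ0.le)
    fun v hv e he => (abs_pow_mul_pow_le_exp (hbox v hv).1 (hbox v hv).2 _ _).trans
      (Real.exp_le_exp.2 (hτ e he))
  have hGd : G.totalDegree ≤ d := (Finset.sup_mono hGF).trans hd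
  have hexp : 1 ≤ Real.exp (ε * τ + b₁ * b₂ / τ) := Real.one_le_exp (by positivity)
  rw [add_mul]
  by_cases hdvd : map (Int.castRingHom ℚ) F ∣ map (Int.castRingHom ℚ) G
  · have hG0 : map (Int.castRingHom ℚ) G ≠ 0 := by
      rwa [Ne, map_eq_zero_iff _ hinj]
    obtain ⟨Q, hQ⟩ := hdvd
    have hQ0 : Q ≠ 0 := by rintro rfl; exact hG0 (by rw [hQ, mul_zero])
    have hQd : Q.totalDegree = 0 := by
      have h2 := totalDegree_mul_of_isDomain hF.ne_zero hQ0
      have h3 : (map (Int.castRingHom ℚ) G).totalDegree ≤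
          (map (Int.castRingHom ℚ) F).totalDegree :=
        Finset.sup_mono (by rw [hsupp, hsupp]; exact hGF)
      rw [hQ] at h3
      omega
    obtain ⟨q, rfl⟩ : ∃ q, Q = C q := ⟨_, totalDegree_eq_zero_iff_eq_C.1 hQd⟩
    have hq : q ≠ 0 := by rintro rfl; exact hQ0 C_0
    have hsuppG : G.support = F.support := by
      rw [← hsupp G, ← hsupp F, hQ, mul_comm]
      ext e
      simp [mem_support_iff, coeff_C_mul, hq]
    have hdeg : ∀ k, (map (Int.castRingHom ℚ) G).degreeOf k =
        (map (Int.castRingHom ℚ) F).degreeOf k := fun k => by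
      rw [degreeOf_eq_sup, degreeOf_eq_sup, hsupp, hsupp, hsuppG]
    have hassoc : Associated (map (Int.castRingHom ℚ) F) (map (Int.castRingHom ℚ) G) :=
      ⟨(hq.isUnit.map C).unit, hQ.symm⟩
    refine (hC G hGd (hassoc.irreducible hF) (by rwa [hdeg]) (by rwa [hdeg]) b₁ b₂ τ hb₁ hb₂
      (by rwa [hsuppG]) (by rwa [hsuppG]) hb₁τ hb₂τ hεb₁ hεb₂ (fun e => ?_) S hGS hbox).trans
      (le_add_of_nonneg_right (by positivity))
    have hcard : (F.support.card : ℝ) ≤ (d + 1 : ℝ) ^ 2 := by exact_mod_cast card_support_le hd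
    have hexpτ : 1 ≤ Real.exp τ := Real.one_le_exp hτ0.le
    calc _ ≤ _ := hGc e
      _ ≤ ((d + 1 : ℝ) ^ 2 * Real.exp τ) ^ F.support.card := by gcongr
      _ ≤ _ := by
        refine pow_le_pow_right₀ ?_ (card_support_le hd)
        exact one_le_mul_of_one_le_of_one_le
          (one_le_pow₀ (le_add_of_nonneg_left (Nat.cast_nonneg d))) hexpτ
  · have h := card_common_int_zeros_le hF h0 hdvd hd hGd S hS hGS
    have h' : (S.card : ℝ) ≤ d * (d + d) ^ 2 := by exact_mod_cast h
    exact (h'.trans (le_mul_of_one_le_right (by positivity) hexp)).trans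
      (le_add_of_nonneg_left (by positivity))

/-- The number of values of a coordinate in an interval. -/
theorem card_image_coordinate_le (S : Finset (Fin 2 → ℤ)) (i : Fin 2) {b : ℝ}
    (hb : 0 ≤ b) (hS : ∀ v ∈ S, |(v i : ℝ)| ≤ Real.exp b) :
    ((S.image fun v => v i).card : ℝ) ≤ 3 * Real.exp b := by
  have h1 : (S.image fun v => v i) ⊆ Finset.Icc (-⌊Real.exp b⌋) ⌊Real.exp b⌋ := by
    intro x hx
    obtain ⟨v, hv, rfl⟩ := Finset.mem_image.1 hx
    have h := abs_le.1 (hS v hv)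
    rw [Finset.mem_Icc]
    refine ⟨?_, Int.le_floor.2 h.2⟩
    rw [neg_le]
    exact Int.le_floor.2 (by push_cast; linarith)
  have h2 := Finset.card_le_card h1
  rw [Int.card_Icc] at h2
  have h3 : (1 : ℝ) ≤ Real.exp b := Real.one_le_exp hb
  have h4 : (0 : ℤ) ≤ ⌊Real.exp b⌋ := Int.floor_nonneg.2 (Real.exp_pos b).le
  have h5 : ((S.image fun v => v i).card : ℤ) ≤ 2 * ⌊Real.exp b⌋ + 1 := by omega
  have h6 : ((S.image fun v => v i).card : ℝ) ≤ 2 * (⌊Real.exp b⌋ : ℝ) + 1 := by exact_mod_cast h5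
  linarith [Int.floor_le (Real.exp b)]

/-- The trivial bound for the number of integral zeros, from slicing in one coordinate. -/
theorem card_le_of_coordinate {i j : Fin 2} (hij : i ≠ j) {F : MvPolynomial (Fin 2) ℤ} {d : ℕ}
    (hd : F.totalDegree ≤ d) (hF : Irreducible (map (Int.castRingHom ℚ) F))
    (hj : (map (Int.castRingHom ℚ) F).degreeOf j ≠ 0) {b : ℝ} (hb : 0 ≤ b)
    (S : Finset (Fin 2 → ℤ)) (hS : ∀ v ∈ S, eval v F = 0)
    (hbox : ∀ v ∈ S, |(v i : ℝ)| ≤ Real.exp b) : (S.card : ℝ) ≤ d * (3 * Real.exp b) := by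
  classical
  have hinj : Function.Injective fun (v : Fin 2 → ℤ) k => (v k : ℚ) := by
    intro v w h
    funext k
    simpa using congrFun h k
  have h1 : S.card ≤ d * (S.image fun v => v i).card := by
    refine Finset.card_le_mul_card_image S d fun a _ => ?_
    rw [← Finset.card_image_of_injective _ hinj]
    refine (card_le_totalDegree_of_slice_ne_zero hij
      (slice_ne_zero_of_irreducible hij hF hj (a : ℚ)) _ ?_ ?_).trans
      ((totalDegree_map_le _ _).trans hd)
    · simp only [Finset.mem_image, Finset.mem_filter]
      rintro _ ⟨v, ⟨-, hv⟩, rfl⟩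
      exact congrArg Int.cast hv
    · simp only [Finset.mem_image, Finset.mem_filter]
      rintro _ ⟨v, ⟨hv, -⟩, rfl⟩
      rw [eval_map_intCast, hS v hv, Int.cast_zero]
  calc (S.card : ℝ) ≤ d * ((S.image fun v => v i).card : ℝ) := by exact_mod_cast h1
    _ ≤ _ := by gcongr; exact card_image_coordinate_le S i hb hbox

/-- An irreducible polynomial in two variables that depends on one of them only and has a zero is
linear. -/
theorem MvPolynomial.X_sub_C_dvd_of_degreeOf_eq_zero {K : Type*} [Field K] [Infinite K]
    {i j : Fin 2} (hij : i ≠ j) {F : MvPolynomial (Fin 2) K} (hj : F.degreeOf j = 0) {v : Fin 2 → K}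
    (hv : eval v F = 0) : X i - C (v i) ∣ F := by
  refine X_sub_C_dvd_of_slice_eq_zero hij (Polynomial.funext fun t => ?_)
  have h := eval_slice hij (Function.update v j t) F
  rw [Function.update_self, Function.update_of_ne hij] at h
  rw [h, Polynomial.eval_zero, ← hv, eval_eq', eval_eq']
  refine Finset.sum_congr rfl fun e he => ?_
  congr 1
  refine Finset.prod_congr rfl fun k _ => ?_
  rcases eq_or_ne k j with rfl | hk
  · have : e k = 0 := Nat.le_zero.1 (hj ▸ monomial_le_degreeOf k he)
    rw [this, pow_zero, pow_zero]
  · rw [Function.update_of_ne hk]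

/-- Integral zeros of an irreducible polynomial that depends on one variable only. -/
theorem card_le_of_degreeOf_eq_zero {i j : Fin 2} (hij : i ≠ j) {F : MvPolynomial (Fin 2) ℤ}
    (hF : Irreducible (map (Int.castRingHom ℚ) F))
    (hj : (map (Int.castRingHom ℚ) F).degreeOf j = 0) {b : Fin 2 → ℝ} (hb : ∀ k, 0 ≤ b k) {τ : ℝ}
    (hτ0 : 0 < τ) (hτ : ∃ e ∈ F.support, τ = e i * b i + e j * b j)
    (S : Finset (Fin 2 → ℤ)) (hS : ∀ v ∈ S, eval v F = 0)
    (hbox : ∀ v ∈ S, ∀ k, |(v k : ℝ)| ≤ Real.exp (b k)) :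
    (S.card : ℝ) ≤ 3 * Real.exp (b i * b j / τ) := by
  classical
  rcases S.eq_empty_or_nonempty with rfl | ⟨v, hv⟩
  · simp [Real.exp_nonneg]
  set P := map (Int.castRingHom ℚ) F with hP
  have hevP : ∀ w ∈ S, eval (fun k => (w k : ℚ)) P = 0 := fun w hw => by
    rw [hP, eval_map_intCast, hS w hw, Int.cast_zero]
  have hdvd := X_sub_C_dvd_of_degreeOf_eq_zero hij hj (hevP v hv)
  have hnu : ¬ IsUnit (X i - C (v i : ℚ) : MvPolynomial (Fin 2) ℚ) := fun h => by
    have := h.map (eval fun k => (v k : ℚ))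
    simp at this
  have hdvd' : P ∣ X i - C (v i : ℚ) := ((hF.dvd_iff.1 hdvd).resolve_left hnu).dvd
  have hi : ∀ w ∈ S, w i = v i := fun w hw => by
    obtain ⟨Q, hQ⟩ := hdvd'
    have := congrArg (eval fun k => (w k : ℚ)) hQ
    rw [map_mul, hevP w hw, zero_mul] at this
    simp only [map_sub, eval_X, eval_C, sub_eq_zero] at this
    exact_mod_cast this
  have hcard : S.card = (S.image fun w => w j).card := by
    refine (Finset.card_image_of_injOn fun w hw w' hw' h => ?_).symm
    funext k
    have hk : k = i ∨ k = j := by omega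
    rcases hk with rfl | rfl
    · rw [hi w hw, hi w' hw']
    · exact h
  have hτi : τ ≤ b i := by
    obtain ⟨e, he, h⟩ := hτ
    rw [← support_map_of_injective F (f := Int.castRingHom ℚ) Int.cast_injective] at he
    have hne : (X i - C (v i : ℚ) : MvPolynomial (Fin 2) ℚ) ≠ 0 := fun h0 =>
      hF.ne_zero (zero_dvd_iff.1 (h0 ▸ hdvd))
    have hei : e i ≤ 1 := by
      refine (apply_le_totalDegree he i).trans
        ((totalDegree_le_of_dvd_of_isDomain hdvd' hne).trans ((totalDegree_sub _ _).trans ?_))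
      rw [totalDegree_X, totalDegree_C]
      exact le_refl 1
    have hej : e j = 0 := Nat.le_zero.1 (hj ▸ monomial_le_degreeOf j he)
    have hei' : (e i : ℝ) ≤ 1 := by exact_mod_cast hei
    rw [h, hej, Nat.cast_zero, zero_mul, add_zero]
    exact mul_le_of_le_one_left (hb i) hei'
  rw [hcard]
  refine (card_image_coordinate_le S j (hb j) fun w hw => hbox w hw j).trans ?_
  gcongr
  rw [le_div_iff₀ hτ0, mul_comm]
  exact mul_le_mul_of_nonneg_right hτi (hb j)

/-- The number of integral zeros of an irreducible polynomial in a box. -/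
theorem exists_card_le (d : ℕ) {ε : ℝ} (hε : 0 < ε) :
    ∃ c : ℝ, 0 < c ∧ ∀ F : MvPolynomial (Fin 2) ℤ, F.totalDegree ≤ d →
      Irreducible (map (Int.castRingHom ℚ) F) →
      ∀ b : Fin 2 → ℝ, (∀ k, 0 ≤ b k) → ∀ τ : ℝ, 0 < τ →
      (∀ e ∈ F.support, e 0 * b 0 + e 1 * b 1 ≤ τ) →
      (∃ e ∈ F.support, τ = e 0 * b 0 + e 1 * b 1) →
      ∀ S : Finset (Fin 2 → ℤ), (∀ v ∈ S, eval v F = 0) →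
      (∀ v ∈ S, ∀ k, |(v k : ℝ)| ≤ Real.exp (b k)) →
      (S.card : ℝ) ≤ c * Real.exp (ε * τ + b 0 * b 1 / τ) := by
  obtain ⟨c, hc, hC⟩ := exists_card_le_of_exponent_le d hε
  refine ⟨c + 3 * d + 3, by positivity, ?_⟩
  intro F hd hF b hb τ hτ0 hτ hτ' S hS hbox
  have hβ : 0 ≤ b 0 * b 1 / τ := div_nonneg (mul_nonneg (hb 0) (hb 1)) hτ0.le
  have hετ : 0 < ε * τ := by positivity
  have hexp : 0 < Real.exp (ε * τ + b 0 * b 1 / τ) := Real.exp_pos _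
  have hd0 : (0 : ℝ) ≤ d := Nat.cast_nonneg d
  by_cases h0 : (map (Int.castRingHom ℚ) F).degreeOf 0 = 0
  · have h := card_le_of_degreeOf_eq_zero (i := 1) one_ne_zero hF h0 hb hτ0
      (by simpa only [add_comm] using hτ') S hS hbox
    have h2 : Real.exp (b 1 * b 0 / τ) ≤ Real.exp (ε * τ + b 0 * b 1 / τ) := by
      rw [mul_comm (b 1)]
      exact Real.exp_le_exp.2 (by linarith)
    nlinarith
  by_cases h1 : (map (Int.castRingHom ℚ) F).degreeOf 1 = 0
  · have h := card_le_of_degreeOf_eq_zero (i := 0) zero_ne_one hF h1 hb hτ0 hτ' S hS hbox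
    have h2 : Real.exp (b 0 * b 1 / τ) ≤ Real.exp (ε * τ + b 0 * b 1 / τ) :=
      Real.exp_le_exp.2 (by linarith)
    nlinarith
  have hcoord : ∀ i j : Fin 2, i ≠ j → (map (Int.castRingHom ℚ) F).degreeOf j ≠ 0 →
      b i < ε * τ → (S.card : ℝ) ≤ (c + 3 * d + 3) * Real.exp (ε * τ + b 0 * b 1 / τ) := by
    intro i j hij hj hbi
    have h := card_le_of_coordinate hij hd hF hj (hb i) S hS fun v hv => hbox v hv i
    have h2 : Real.exp (b i) ≤ Real.exp (ε * τ + b 0 * b 1 / τ) :=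
      Real.exp_le_exp.2 (by linarith)
    have h3 := mul_le_mul_of_nonneg_left h2 hd0
    nlinarith
  by_cases hb₀ : b 0 < ε * τ
  · exact hcoord 0 1 zero_ne_one h1 hb₀
  by_cases hb₁ : b 1 < ε * τ
  · exact hcoord 1 0 one_ne_zero h0 hb₁
  have hbτ : ∀ k, (map (Int.castRingHom ℚ) F).degreeOf k ≠ 0 → b k ≤ τ := by
    intro k hk
    obtain ⟨e, he, hek⟩ : ∃ e ∈ F.support, 0 < e k := by
      by_contra! h
      refine hk ?_
      rw [← Nat.le_zero, degreeOf_eq_sup]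
      exact Finset.sup_le fun e he => h e (support_map_subset _ _ he)
    have hek' : (1 : ℝ) ≤ e k := by exact_mod_cast hek
    have h2 := hτ e he
    have h3 : b k ≤ e k * b k := le_mul_of_one_le_left (hb k) hek'
    have h4 : ∀ l, 0 ≤ (e l : ℝ) * b l := fun l => mul_nonneg (Nat.cast_nonneg _) (hb l)
    fin_cases k
    · exact h3.trans ((le_add_of_nonneg_right (h4 1)).trans h2)
    · exact h3.trans ((le_add_of_nonneg_left (h4 0)).trans h2)
  have h := hC F hd hF h0 h1 (b 0) (b 1) τ (hετ.trans_le (not_lt.1 hb₀))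
    (hετ.trans_le (not_lt.1 hb₁)) hτ hτ' (hbτ 0 h0) (hbτ 1 h1) (not_lt.1 hb₀) (not_lt.1 hb₁) S hS
    fun v hv => ⟨hbox v hv 0, hbox v hv 1⟩
  nlinarith

end Assembly

/-- (Lopsided Bombieri–Pila; Browning–Heath-Brown, Dietmann.) Let
`F ∈ ℤ[x₁,x₂]` be irreducible over `ℚ` of total degree `d`, let `B₁, B₂ ≥ 1`, and let
`T = max B₁^{e₁}B₂^{e₂}` over monomials `x₁^{e₁}x₂^{e₂}` occurring in `F` (with `T > 1`).
Then `N(F;B₁,B₂) ≪_{d,ε} T^ε · exp(log B₁ · log B₂ / log T)`. -/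
theorem lopsided_bombieri_pila (d : ℕ) (hd : 1 ≤ d) (ε : ℝ) (hε : 0 < ε) :
    ∃ c : ℝ, 0 < c ∧
      ∀ F : MvPolynomial (Fin 2) ℤ, F.totalDegree = d →
        Irreducible (MvPolynomial.map (Int.castRingHom ℚ) F) →
        ∀ B₁ B₂ T : ℝ, 1 ≤ B₁ → 1 ≤ B₂ → 1 < T →
          IsGreatest ((fun m : Fin 2 →₀ ℕ => B₁ ^ m 0 * B₂ ^ m 1) '' ↑F.support) T →
          (Nat.card {p : ℤ × ℤ //
              MvPolynomial.eval ![p.1, p.2] F = 0 ∧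
                |(p.1 : ℝ)| ≤ B₁ ∧ |(p.2 : ℝ)| ≤ B₂} : ℝ)
            ≤ c * T ^ ε * Real.exp (Real.log B₁ * Real.log B₂ / Real.log T) := by
  obtain ⟨c, hc, hC⟩ := exists_card_le d hε
  refine ⟨c, hc, fun F hFd hF B₁ B₂ T hB₁ hB₂ hT hmax => ?_⟩
  have hT0 : 0 < T := one_pos.trans hT
  have hB₁' : Real.exp (Real.log B₁) = B₁ := Real.exp_log (one_pos.trans_le hB₁)
  have hB₂' : Real.exp (Real.log B₂) = B₂ := Real.exp_log (one_pos.trans_le hB₂)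
  have hlog : ∀ e : Fin 2 →₀ ℕ,
      B₁ ^ e 0 * B₂ ^ e 1 = Real.exp (e 0 * Real.log B₁ + e 1 * Real.log B₂) := fun e => by
    rw [Real.exp_add, Real.exp_nat_mul, Real.exp_nat_mul, hB₁', hB₂']
  have hrhs : T ^ ε * Real.exp (Real.log B₁ * Real.log B₂ / Real.log T) =
      Real.exp (ε * Real.log T + Real.log B₁ * Real.log B₂ / Real.log T) := by
    rw [Real.exp_add, Real.rpow_def_of_pos hT0, mul_comm ε]
  rw [mul_assoc, hrhs]
  cases finite_or_infinite {p : ℤ × ℤ // MvPolynomial.eval ![p.1, p.2] F = 0 ∧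
      |(p.1 : ℝ)| ≤ B₁ ∧ |(p.2 : ℝ)| ≤ B₂} with
  | inr h =>
    rw [Nat.card_eq_zero_of_infinite, Nat.cast_zero]
    positivity
  | inl h =>
    have := Fintype.ofFinite {p : ℤ × ℤ // MvPolynomial.eval ![p.1, p.2] F = 0 ∧
      |(p.1 : ℝ)| ≤ B₁ ∧ |(p.2 : ℝ)| ≤ B₂}
    let f : {p : ℤ × ℤ // MvPolynomial.eval ![p.1, p.2] F = 0 ∧
        |(p.1 : ℝ)| ≤ B₁ ∧ |(p.2 : ℝ)| ≤ B₂} ↪ (Fin 2 → ℤ) :=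
      ⟨fun p => ![p.1.1, p.1.2], fun p q hpq =>
        Subtype.ext (Prod.ext (congrFun hpq 0) (congrFun hpq 1))⟩
    rw [Nat.card_eq_fintype_card, ← Finset.card_univ, ← Finset.card_map f]
    refine hC F hFd.le hF ![Real.log B₁, Real.log B₂] ?_ (Real.log T) (Real.log_pos hT) ?_ ?_ _
      ?_ ?_
    · intro k
      fin_cases k
      · exact Real.log_nonneg hB₁
      · exact Real.log_nonneg hB₂
    · intro e he
      rw [Real.le_log_iff_exp_le hT0]
      exact (hlog e).symm.trans_le (hmax.2 ⟨e, he, rfl⟩)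
    · obtain ⟨e, he, h⟩ := hmax.1
      refine ⟨e, he, ?_⟩
      rw [← h]
      exact (congrArg Real.log (hlog e)).trans (Real.log_exp _)
    · simp only [Finset.mem_map, Finset.mem_univ, true_and]
      rintro _ ⟨p, rfl⟩
      exact p.2.1
    · simp only [Finset.mem_map, Finset.mem_univ, true_and]
      rintro _ ⟨p, rfl⟩ k
      fin_cases k
      · exact p.2.2.1.trans_eq hB₁'.symm
      · exact p.2.2.2.trans_eq hB₂'.symm
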